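/- Fix a, b, c ∈ ℕ with n = a + b + c ≥ 1 and strengths 0 < s_A < s_B < s_C satisfying s_A/s_B ≤ 1/2 and s_B/s_C ≤ 1/2. Then there is a constant C, depending only on the ratios s_A/s_B and s_B/s_C, such that the Jump/Hop chain X_t(n) on Ω_{a,b,c} has mixing time t(X_t(n)) ≤ C·n^4. -/

import Mathlib

open Finset

/-- Total-variation mixing time: the least `T` such that for every starting state `x`
and every `t ≥ T`, the TV distance between `P^t(x, ·)` and `π` is at most `1/4`. -/
noncomputable def mixingTime {Ω : Type*} [Fintype Ω] [DecidableEq Ω]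
    (P : Matrix Ω Ω ℝ) (π : Ω → ℝ) : ℕ :=
  sInf {T : ℕ | ∀ x : Ω, ∀ t : ℕ, T ≤ t →
    (1 / 2) * ∑ y : Ω, |(P ^ t) x y - π y| ≤ 1 / 4}

/-- State space `Ω_{n₁,…,n_k}` of the linear particle system: words of length `n`
over `{1,…,k}` with exactly `cnt j` letters equal to `j`. -/
abbrev PSpace (n k : ℕ) (cnt : Fin k → ℕ) : Type :=
  {w : Fin n → Fin k // ∀ j : Fin k, (Finset.univ.filter fun i => w i = j).card = cnt j}

/-- Transition matrix of the linear particle system `X_k(n)`: from state `v`, a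
position `i` with `i+1 < n` is chosen uniformly; if the two letters are equal nothing
happens, otherwise they are swapped with probability `s(v i)/(s(v i)+s(v (i+1)))`. -/
noncomputable def partP (n k : ℕ) (cnt : Fin k → ℕ) (s : Fin k → ℝ) :
    Matrix (PSpace n k cnt) (PSpace n k cnt) ℝ :=
  fun v u => (1 / ((n : ℝ) - 1)) * ∑ i : Fin n, ∑ j : Fin n,
    if (j : ℕ) = (i : ℕ) + 1 then
      if v.1 i = v.1 j then (if u = v then 1 else 0)
      else
        (s (v.1 i) / (s (v.1 i) + s (v.1 j))) *
          (if u.1 = v.1 ∘ Equiv.swap i j then 1 else 0)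
        + (s (v.1 j) / (s (v.1 i) + s (v.1 j))) *
          (if u = v then 1 else 0)
    else 0

/-- Unnormalized stationary weight of the linear particle system:
`w(v) = ∏_i s(v i)^i` (positions counted `1,…,n`). -/
noncomputable def partW (n k : ℕ) (cnt : Fin k → ℕ) (s : Fin k → ℝ)
    (v : PSpace n k cnt) : ℝ :=
  ∏ i : Fin n, s (v.1 i) ^ ((i : ℕ) + 1)

/-- Stationary distribution of the linear particle system. -/
noncomputable def partPi (n k : ℕ) (cnt : Fin k → ℕ) (s : Fin k → ℝ)
    (v : PSpace n k cnt) : ℝ :=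
  partW n k cnt s v / ∑ u : PSpace n k cnt, partW n k cnt s u

/-- Transition matrix of the Jump/Hop chain `X_t(n)` on `Ω_{a,b,c}`; letters of the
alphabet `Fin 3` are `0 = A`, `1 = B`, `2 = C`.  A pair of positions `i < j` is chosen
uniformly at random and a Jump or Hop move is performed when its preconditions hold. -/
noncomputable def jumpP (a b c : ℕ) (sA sB sC : ℝ) :
    Matrix (PSpace (a + b + c) 3 ![a, b, c]) (PSpace (a + b + c) 3 ![a, b, c]) ℝ :=
  fun v u =>
    (1 / ((a + b + c).choose 2 : ℝ)) *
      ∑ i : Fin (a + b + c), ∑ j : Fin (a + b + c),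
        if i < j then
          if ((v.1 i = 0 ∧ v.1 j = 2) ∨ (v.1 i = 2 ∧ v.1 j = 0)) ∧
              (∀ l, i < l → l < j → v.1 l = 1) then
            -- Jump
            ((sC / sA) ^ ((j : ℕ) - (i : ℕ)) / (1 + (sC / sA) ^ ((j : ℕ) - (i : ℕ)))) *
              (if u.1 = (fun x => if x = i then (0 : Fin 3) else if x = j then 2 else v.1 x)
                then 1 else 0)
            + (1 / (1 + (sC / sA) ^ ((j : ℕ) - (i : ℕ)))) *
              (if u.1 = (fun x => if x = i then (2 : Fin 3) else if x = j then 0 else v.1 x)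
                then 1 else 0)
          else if (v.1 i = 0 ∧ ∀ l, i < l → l ≤ j → v.1 l = 1) ∨
                  (v.1 j = 0 ∧ ∀ l, i ≤ l → l < j → v.1 l = 1) then
            -- Hop, A–B case
            ((sB / sA) ^ ((j : ℕ) - (i : ℕ)) / (1 + (sB / sA) ^ ((j : ℕ) - (i : ℕ)))) *
              (if u.1 = (fun x => if x = i then (0 : Fin 3)
                  else if i ≤ x ∧ x ≤ j then 1 else v.1 x) then 1 else 0)
            + (1 / (1 + (sB / sA) ^ ((j : ℕ) - (i : ℕ)))) *
              (if u.1 = (fun x => if x = j then (0 : Fin 3)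
                  else if i ≤ x ∧ x ≤ j then 1 else v.1 x) then 1 else 0)
          else if (v.1 i = 2 ∧ ∀ l, i < l → l ≤ j → v.1 l = 1) ∨
                  (v.1 j = 2 ∧ ∀ l, i ≤ l → l < j → v.1 l = 1) then
            -- Hop, B–C case
            ((sC / sB) ^ ((j : ℕ) - (i : ℕ)) / (1 + (sC / sB) ^ ((j : ℕ) - (i : ℕ)))) *
              (if u.1 = (fun x => if x = j then (2 : Fin 3)
                  else if i ≤ x ∧ x ≤ j then 1 else v.1 x) then 1 else 0)
            + (1 / (1 + (sC / sB) ^ ((j : ℕ) - (i : ℕ)))) *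
              (if u.1 = (fun x => if x = i then (2 : Fin 3)
                  else if i ≤ x ∧ x ≤ j then 1 else v.1 x) then 1 else 0)
          else (if u = v then 1 else 0)
        else 0

section Abstract

variable {Ω E : Type*} [Fintype Ω] [Fintype E]

/-- Generator of the dynamics in which edge `e` moves `x` to `σ e x` at rate `c e x`. -/
def edgeGen (σ : E → Ω → Ω) (c : E → Ω → ℝ) (f : Ω → ℝ) (x : Ω) : ℝ :=
  ∑ e, c e x * (f (σ e x) - f x)

/-- Dirichlet form of `edgeGen` with respect to the weight `π`. -/
noncomputable def edgeEnergy (σ : E → Ω → Ω) (c : E → Ω → ℝ) (π f : Ω → ℝ) : ℝ :=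
  (1 / 2) * ∑ e, ∑ x, π x * c e x * (f (σ e x) - f x) ^ 2

lemma sum_involutive_symm {τ : Ω → Ω} (hτ : ∀ x, τ (τ x) = x) (F : Ω → ℝ) :
    ∑ x, F (τ x) = ∑ x, F x :=
  Equiv.sum_comp (⟨τ, τ, hτ, hτ⟩ : Ω ≃ Ω) F

/-- Symmetrization of a sum over the orbits of an involution. -/
lemma sum_eq_half_sum_involutive {τ : Ω → Ω} (hτ : ∀ x, τ (τ x) = x) (F : Ω → ℝ) :
    ∑ x, F x = (1 / 2) * ∑ x, (F x + F (τ x)) := by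
  rw [sum_add_distrib, sum_involutive_symm hτ]; ring

variable {σ : E → Ω → Ω} {c : E → Ω → ℝ} {π : Ω → ℝ}

lemma sum_mul_edgeGen (hσ : ∀ e x, σ e (σ e x) = x)
    (hrev : ∀ e x, π x * c e x = π (σ e x) * c e (σ e x)) (f : Ω → ℝ) :
    ∑ x, π x * (f x * edgeGen σ c f x) = - edgeEnergy σ c π f := by
  unfold edgeGen edgeEnergy
  simp_rw [mul_sum]
  rw [sum_comm, ← sum_neg_distrib]
  refine sum_congr rfl fun e _ => ?_
  rw [sum_eq_half_sum_involutive (hσ e), mul_sum, ← sum_neg_distrib]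
  refine sum_congr rfl fun x _ => ?_
  rw [hσ]
  linear_combination (1 / 2) * f (σ e x) * (f (σ e x) - f x) * hrev e x

lemma sum_edgeGen (hσ : ∀ e x, σ e (σ e x) = x)
    (hrev : ∀ e x, π x * c e x = π (σ e x) * c e (σ e x)) (f : Ω → ℝ) :
    ∑ x, π x * edgeGen σ c f x = 0 := by
  unfold edgeGen
  simp_rw [mul_sum]
  rw [sum_comm]
  refine sum_eq_zero fun e _ => ?_
  rw [sum_eq_half_sum_involutive (hσ e)]
  refine mul_eq_zero_of_right _ (sum_eq_zero fun x _ => ?_)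
  rw [hσ]
  linear_combination (f (σ e x) - f x) * hrev e x

/-- A positive function `V` bounds the Dirichlet form from below by the multiplication
operator `- (L V) / V`. -/
lemma sum_sq_mul_neg_edgeGen_div_le (hσ : ∀ e x, σ e (σ e x) = x)
    (hrev : ∀ e x, π x * c e x = π (σ e x) * c e (σ e x))
    (hπ : ∀ x, 0 < π x) (hc : ∀ e x, 0 ≤ c e x) {V : Ω → ℝ} (hV : ∀ x, 0 < V x) (f : Ω → ℝ) :
    ∑ x, π x * (f x ^ 2 * (- edgeGen σ c V x / V x)) ≤ edgeEnergy σ c π f := by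
  have h1 : ∀ x, π x * (f x ^ 2 * (- edgeGen σ c V x / V x)) =
      ∑ e, π x * c e x * (f x ^ 2 * (1 - V (σ e x) / V x)) := by
    intro x
    have := (hV x).ne'
    unfold edgeGen
    rw [← sum_neg_distrib, sum_div, mul_sum, mul_sum]
    refine sum_congr rfl fun e _ => ?_
    field_simp
    ring
  simp_rw [h1]
  unfold edgeEnergy
  rw [sum_comm, mul_sum]
  refine sum_le_sum fun e _ => ?_
  rw [sum_eq_half_sum_involutive (hσ e)]
  refine mul_le_mul_of_nonneg_left (sum_le_sum fun x _ => ?_) (by norm_num)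
  rw [hσ, ← hrev, ← mul_add]
  refine mul_le_mul_of_nonneg_left ?_ (mul_nonneg (hπ x).le (hc e x))
  have a := hV x
  have b := hV (σ e x)
  have : 0 ≤ (f x * V (σ e x) - f (σ e x) * V x) ^ 2 / (V x * V (σ e x)) := by positivity
  have h2 : (f x * V (σ e x) - f (σ e x) * V x) ^ 2 / (V x * V (σ e x)) =
    f x ^ 2 * (V (σ e x) / V x) + f (σ e x) ^ 2 * (V x / V (σ e x)) - 2 * (f x * f (σ e x)) := by
    field_simp
    ring
  nlinarith

/-- One step of the chain which picks an edge uniformly contracts `ℓ²(π)`. -/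
lemma sum_sq_step_le [Nonempty E] (hσ : ∀ e x, σ e (σ e x) = x)
    (hrev : ∀ e x, π x * c e x = π (σ e x) * c e (σ e x))
    (hπ : ∀ x, 0 < π x) (hc : ∀ e x, 0 ≤ c e x)
    (hc1 : ∀ e x, c e x + c e (σ e x) ≤ 1) (f : Ω → ℝ) :
    ∑ x, π x * (f x + (1 / (Fintype.card E : ℝ)) * edgeGen σ c f x) ^ 2 ≤
      ∑ x, π x * f x ^ 2 - (1 / (Fintype.card E : ℝ)) * edgeEnergy σ c π f := by
  set N : ℝ := (Fintype.card E : ℝ) with hN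
  have hNpos : 0 < N := by simp only [hN]; exact_mod_cast Fintype.card_pos
  have hstep : ∀ x, f x + (1 / N) * edgeGen σ c f x =
      (1 / N) * ∑ e, (f x + c e x * (f (σ e x) - f x)) := by
    intro x
    rw [sum_add_distrib, sum_const, card_univ, nsmul_eq_mul, ← hN, edgeGen]
    field_simp
  have hjensen : ∀ x, (f x + (1 / N) * edgeGen σ c f x) ^ 2 ≤
      (1 / N) * ∑ e, (f x + c e x * (f (σ e x) - f x)) ^ 2 := by
    intro x
    rw [hstep, mul_pow]
    have := sq_sum_le_card_mul_sum_sq (s := (univ : Finset E))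
      (f := fun e => f x + c e x * (f (σ e x) - f x))
    rw [card_univ, ← hN] at this
    calc _ ≤ (1 / N) ^ 2 * (N * ∑ e, (f x + c e x * (f (σ e x) - f x)) ^ 2) := by gcongr
      _ = _ := by field_simp
  have hproj : ∀ e, ∑ x, π x * (f x + c e x * (f (σ e x) - f x)) ^ 2 ≤
      ∑ x, π x * (f x * (f x + c e x * (f (σ e x) - f x))) := by
    intro e
    rw [sum_eq_half_sum_involutive (hσ e),
      sum_eq_half_sum_involutive (hσ e) (fun x => π x * (f x * (f x + c e x * (f (σ e x) - f x))))]
    refine mul_le_mul_of_nonneg_left (sum_le_sum fun x _ => ?_) (by norm_num)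
    rw [hσ]
    have key : π x * (f x * (f x + c e x * (f (σ e x) - f x))) +
        π (σ e x) * (f (σ e x) * (f (σ e x) + c e (σ e x) * (f x - f (σ e x)))) -
        (π x * (f x + c e x * (f (σ e x) - f x)) ^ 2 +
        π (σ e x) * (f (σ e x) + c e (σ e x) * (f x - f (σ e x))) ^ 2) =
        (π x * c e x) * ((f (σ e x) - f x) ^ 2 * (1 - c e x - c e (σ e x))) := by
      linear_combination ((f x - f (σ e x)) * (f (σ e x) + c e (σ e x) * (f x - f (σ e x)))) *
        hrev e x
    have : 0 ≤ (π x * c e x) * ((f (σ e x) - f x) ^ 2 * (1 - c e x - c e (σ e x))) :=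
      mul_nonneg (mul_nonneg (hπ x).le (hc e x))
        (mul_nonneg (sq_nonneg _) (by linarith [hc1 e x]))
    linarith
  calc ∑ x, π x * (f x + (1 / N) * edgeGen σ c f x) ^ 2
      ≤ ∑ x, π x * ((1 / N) * ∑ e, (f x + c e x * (f (σ e x) - f x)) ^ 2) :=
        sum_le_sum fun x _ => mul_le_mul_of_nonneg_left (hjensen x) (hπ x).le
    _ = (1 / N) * ∑ e, ∑ x, π x * (f x + c e x * (f (σ e x) - f x)) ^ 2 := by
        rw [sum_comm, mul_sum]
        refine sum_congr rfl fun x _ => ?_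
        rw [mul_left_comm, mul_sum]
    _ ≤ (1 / N) * ∑ e, ∑ x, π x * (f x * (f x + c e x * (f (σ e x) - f x))) := by
        exact mul_le_mul_of_nonneg_left (sum_le_sum fun e _ => hproj e) (by positivity)
    _ = ∑ x, π x * (f x * (f x + (1 / N) * edgeGen σ c f x)) := by
        rw [sum_comm, mul_sum]
        refine sum_congr rfl fun x _ => ?_
        rw [hstep, ← mul_sum, ← mul_sum]
        ring
    _ = _ := by
        simp_rw [mul_add, sum_add_distrib]
        rw [sub_eq_add_neg, ← mul_neg, ← sum_mul_edgeGen hσ hrev, mul_sum]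
        congr 1
        · exact sum_congr rfl fun x _ => by ring
        · exact sum_congr rfl fun x _ => by ring


lemma edge_mulVec [DecidableEq Ω] [Nonempty E] {P : Matrix Ω Ω ℝ}
    (hP : ∀ x y, P x y = (1 / (Fintype.card E : ℝ)) * ∑ e,
      ((1 - c e x) * (if y = x then 1 else 0) + c e x * (if y = σ e x then 1 else 0)))
    (f : Ω → ℝ) (x : Ω) :
    (P.mulVec f) x = f x + (1 / (Fintype.card E : ℝ)) * edgeGen σ c f x := by
  have hN : (Fintype.card E : ℝ) ≠ 0 := by exact_mod_cast Fintype.card_ne_zero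
  simp only [Matrix.mulVec, dotProduct, hP]
  simp_rw [mul_assoc, sum_mul]
  rw [← mul_sum, sum_comm]
  have : ∀ e, ∑ y, ((1 - c e x) * (if y = x then 1 else 0) +
      c e x * (if y = σ e x then 1 else 0)) * f y = f x + c e x * (f (σ e x) - f x) := by
    intro e
    simp only [add_mul, sum_add_distrib, mul_ite, mul_one, mul_zero, ite_mul, zero_mul,
      sum_ite_eq', mem_univ, if_true]
    ring
  simp_rw [this]
  rw [sum_add_distrib, sum_const, card_univ, nsmul_eq_mul, edgeGen]
  field_simp

/-- Quantitative convergence to equilibrium from a Poincaré inequality. -/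
lemma sq_sum_abs_pow_sub_le [DecidableEq Ω] [Nonempty E] {P : Matrix Ω Ω ℝ}
    (hP : ∀ x y, P x y = (1 / (Fintype.card E : ℝ)) * ∑ e,
      ((1 - c e x) * (if y = x then 1 else 0) + c e x * (if y = σ e x then 1 else 0)))
    (hσ : ∀ e x, σ e (σ e x) = x)
    (hrev : ∀ e x, π x * c e x = π (σ e x) * c e (σ e x))
    (hπ : ∀ x, 0 < π x) (hπ1 : ∑ x, π x = 1) (hc : ∀ e x, 0 ≤ c e x)
    (hc1 : ∀ e x, c e x + c e (σ e x) ≤ 1) {C : ℝ} (hC : 1 ≤ C)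
    (hpoin : ∀ f : Ω → ℝ, ∑ x, π x * f x = 0 → ∑ x, π x * f x ^ 2 ≤ C * edgeEnergy σ c π f)
    (t : ℕ) (x : Ω) :
    (∑ y, |(P ^ t) x y - π y|) ^ 2 ≤ (1 - 1 / (C * Fintype.card E)) ^ t / π x := by
  set N : ℝ := (Fintype.card E : ℝ) with hN
  have hN1 : 1 ≤ N := by simp only [hN]; exact_mod_cast Fintype.card_pos
  have hC0 : 0 < C := by linarith
  have hκ : 0 ≤ 1 - 1 / (C * N) := by
    have : 1 ≤ C * N := by nlinarith
    have := (div_le_one (by positivity : 0 < C * N)).2 this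
    linarith
  set g : ℕ → Ω → ℝ := fun t => (P ^ t).mulVec (fun y => (if y = x then 1 / π x else 0) - 1) with hg
  have hgs : ∀ t, g (t + 1) = P.mulVec (g t) := fun t => by
    simp only [hg, pow_succ', Matrix.mulVec_mulVec]
  have hstep : ∀ f y, (P.mulVec f) y = f y + (1 / N) * edgeGen σ c f y := edge_mulVec hP
  have hmean : ∀ t, ∑ y, π y * g t y = 0 := by
    intro t
    induction t with
    | zero =>
      have : (π x)⁻¹ * π x = 1 := inv_mul_cancel₀ (hπ x).ne'
      simp [hg, mul_sub, sum_sub_distrib, hπ1, (hπ x).ne']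
    | succ t ih =>
      rw [hgs]
      simp_rw [hstep, mul_add, sum_add_distrib, mul_left_comm (π _) (1 / N)]
      rw [ih, ← mul_sum, sum_edgeGen hσ hrev]; simp
  have hnorm : ∀ t, ∑ y, π y * g t y ^ 2 ≤ (1 - 1 / (C * N)) ^ t / π x := by
    intro t
    induction t with
    | zero =>
      have h1 : ∑ y, π y * g 0 y ^ 2 = 1 / π x - 1 := by
        have : ∀ y, π y * g 0 y ^ 2 = (if y = x then π y * ((1 / π x) ^ 2 - 2 * (1 / π x)) else 0)
            + π y := by
          intro y
          simp only [hg, pow_zero, Matrix.one_mulVec]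
          split_ifs <;> ring
        simp_rw [this, sum_add_distrib, hπ1]
        rw [sum_ite_eq' univ x]
        have := (hπ x).ne'
        simp only [mem_univ, if_true]
        field_simp
        ring
      rw [h1, pow_zero]; linarith
    | succ t ih =>
      rw [hgs]
      simp_rw [hstep]
      refine (sum_sq_step_le hσ hrev hπ hc hc1 (g t)).trans ?_
      have h2 := hpoin (g t) (hmean t)
      have h3 : (1 / (C * N)) * ∑ y, π y * g t y ^ 2 ≤ (1 / N) * edgeEnergy σ c π (g t) := by
        calc _ ≤ (1 / (C * N)) * (C * edgeEnergy σ c π (g t)) := by gcongr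
          _ = _ := by field_simp
      calc _ ≤ (1 - 1 / (C * N)) * ∑ y, π y * g t y ^ 2 := by linarith
        _ ≤ (1 - 1 / (C * N)) * ((1 - 1 / (C * N)) ^ t / π x) := by gcongr
        _ = _ := by rw [pow_succ]; ring
  have hrevP : ∀ y z, π y * P y z = π z * P z y := by
    intro y z
    rw [hP, hP, mul_left_comm, mul_left_comm (π z)]
    congr 1
    rw [mul_sum, mul_sum]
    refine sum_congr rfl fun e _ => ?_
    by_cases hyz : z = y
    · subst hyz; rfl
    · have hzy : y ≠ z := fun h => hyz h.symm
      simp only [hyz, hzy, if_false, mul_zero, zero_add]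
      by_cases h : z = σ e y
      · subst h
        simp only [hσ, if_true, mul_one]
        exact hrev e y
      · have h' : y ≠ σ e z := fun h2 => h (by rw [h2, hσ])
        simp [h, h']
  have hrevPt : ∀ t y z, π y * (P ^ t) y z = π z * (P ^ t) z y := by
    intro t
    induction t with
    | zero =>
      intro y z
      by_cases h : y = z
      · subst h; rfl
      · simp [Matrix.one_apply_ne h, Matrix.one_apply_ne (Ne.symm h)]
    | succ t ih =>
      intro y z
      rw [pow_succ, Matrix.mul_apply, ← pow_succ, pow_succ', Matrix.mul_apply, mul_sum, mul_sum]
      refine sum_congr rfl fun w _ => ?_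
      rw [← mul_assoc, ih, mul_right_comm, hrevP w z]; ring
  have hone : ∀ t y, ∑ z, (P ^ t) y z = 1 := by
    intro t
    have : (P ^ t).mulVec (fun _ => (1 : ℝ)) = fun _ => 1 := by
      induction t with
      | zero => simp
      | succ t ih =>
        rw [pow_succ', ← Matrix.mulVec_mulVec, ih]
        funext y
        rw [hstep]
        simp [edgeGen]
    intro y
    have := congrFun this y
    simpa [Matrix.mulVec, dotProduct] using this
  have hval : ∀ y, |(P ^ t) x y - π y| = π y * |g t y| := by
    intro y
    have : π y * g t y = (P ^ t) x y - π y := by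
      simp only [hg, Matrix.mulVec, dotProduct, mul_sub, mul_ite, mul_zero, mul_one,
        sum_sub_distrib, sum_ite_eq', mem_univ, if_true, hone]
      have := hrevPt t y x
      have h4 := (hπ x).ne'
      field_simp
      linarith
    rw [← this, abs_mul, abs_of_pos (hπ y)]
  simp_rw [hval]
  refine le_trans ?_ (hnorm t)
  calc (∑ y, π y * |g t y|) ^ 2 = (∑ y, √(π y) * (√(π y) * |g t y|)) ^ 2 := by
        congr 1
        exact sum_congr rfl fun y _ => by rw [← mul_assoc, Real.mul_self_sqrt (hπ y).le]
    _ ≤ (∑ y, √(π y) ^ 2) * ∑ y, (√(π y) * |g t y|) ^ 2 := sum_mul_sq_le_sq_mul_sq _ _ _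
    _ = _ := by
        simp_rw [mul_pow, Real.sq_sqrt (hπ _).le, sq_abs]
        rw [hπ1, one_mul]


/-- Recursive constant controlling the mass of `f ^ 2` on sublevel sets of the Lyapunov function
by the Dirichlet form. -/
noncomputable def levelConst (δ B : ℝ) : ℕ → ℝ
  | 0 => 0
  | M + 1 => 8 + 2 * (B * (1 + δ * M) * levelConst δ B M)

lemma levelConst_nonneg {δ B : ℝ} (hδ : 0 ≤ δ) (hB : 0 ≤ B) (M : ℕ) : 0 ≤ levelConst δ B M := by
  induction M with
  | zero => exact le_rfl
  | succ M ih => unfold levelConst; positivity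

/-- If every state other than `o` has an edge which is used with rate at least `1/2` and decreases
`V` by `δ`, and few such edges lead to a given state, then functions vanishing at `o` are controlled
on sublevel sets of `V` by the Dirichlet form. -/
lemma sum_sublevel_sq_le [DecidableEq Ω] [Nonempty E] (hσ : ∀ e x, σ e (σ e x) = x)
    (hrev : ∀ e x, π x * c e x = π (σ e x) * c e (σ e x))
    (hπ : ∀ x, 0 < π x) (hc : ∀ e x, 0 ≤ c e x)
    (hc1 : ∀ e x, c e x + c e (σ e x) ≤ 1) {V : Ω → ℝ} (hV : ∀ x, 1 ≤ V x)
    {δ B : ℝ} (hδ : 0 < δ) (hB : 0 ≤ B) (D : E → Ω → Prop) [∀ e x, Decidable (D e x)]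
    (hD : ∀ e x, D e x → 1 / 2 ≤ c e x ∧ V (σ e x) ≤ V x - δ)
    (o : Ω) (hex : ∀ x, x ≠ o → ∃ e, D e x)
    (hcount : ∀ y, ((univ.filter fun e => D e (σ e y)).card : ℝ) ≤ B * V y)
    {f : Ω → ℝ} (hf : f o = 0) (M : ℕ) :
    ∑ x ∈ univ.filter (fun x => V x ≤ 1 + δ * M), π x * f x ^ 2 ≤
      levelConst δ B M * edgeEnergy σ c π f := by
  have hQ : 0 ≤ edgeEnergy σ c π f := by
    unfold edgeEnergy
    refine mul_nonneg (by norm_num) (sum_nonneg fun e _ => sum_nonneg fun x _ => ?_)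
    exact mul_nonneg (mul_nonneg (hπ x).le (hc e x)) (sq_nonneg _)
  choose! ε hε using hex
  induction M with
  | zero =>
    simp only [levelConst, zero_mul]
    refine (sum_eq_zero fun x hx => ?_).le
    have hx' := (mem_filter.1 hx).2
    by_cases hxo : x = o
    · rw [hxo, hf]; ring
    · have h1 := (hD _ _ (hε x hxo)).2
      have h2 := hV (σ (ε x) x)
      simp only [Nat.cast_zero, mul_zero] at hx'
      linarith
  | succ M ih =>
    set S := univ.filter (fun x => V x ≤ 1 + δ * (M + 1 : ℕ)) with hS
    set S' := S.filter (fun x => x ≠ o) with hS'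
    set T := univ.filter (fun x => V x ≤ 1 + δ * M) with hT
    set nx : Ω → Ω := fun x => σ (ε x) x with hnx
    have hmem : ∀ x ∈ S', x ≠ o ∧ nx x ∈ T := by
      intro x hx
      obtain ⟨hxS, hxo⟩ := mem_filter.1 hx
      refine ⟨hxo, mem_filter.2 ⟨mem_univ _, ?_⟩⟩
      have h1 := (hD _ _ (hε x hxo)).2
      have h2 := (mem_filter.1 hxS).2
      push_cast at h2
      simp only [hnx]
      linarith
    have h1 : ∑ x ∈ S, π x * f x ^ 2 = ∑ x ∈ S', π x * f x ^ 2 := by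
      refine (sum_filter_of_ne (p := fun x => x ≠ o) ?_).symm
      intro x _ hx hxo
      exact hx (by rw [hxo, hf]; ring)
    have h2 : ∀ x ∈ S', π x * f x ^ 2 ≤
        4 * (π x * c (ε x) x * (f (σ (ε x) x) - f x) ^ 2) + 2 * (π (nx x) * f (nx x) ^ 2) := by
      intro x hx
      have hxo := (hmem x hx).1
      have hcx := (hD _ _ (hε x hxo)).1
      have hle : π x ≤ π (nx x) := by
        have := hrev (ε x) x
        have h3 := hc1 (ε x) x
        have h4 := hπ x
        have h5 := hπ (nx x)
        simp only [hnx] at h5 ⊢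
        nlinarith
      have a1 : π x * f x ^ 2 ≤ 2 * (π x * (f (nx x) - f x) ^ 2) + 2 * (π x * f (nx x) ^ 2) := by
        nlinarith [mul_nonneg (hπ x).le (sq_nonneg (f x - 2 * f (nx x)))]
      have a2 : π x * f (nx x) ^ 2 ≤ π (nx x) * f (nx x) ^ 2 := by gcongr
      have a3 : π x * (f (nx x) - f x) ^ 2 ≤ 2 * (π x * c (ε x) x * (f (nx x) - f x) ^ 2) := by
        nlinarith [mul_nonneg (hπ x).le (sq_nonneg (f (nx x) - f x))]
      simp only [hnx] at a1 a2 a3 ⊢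
      linarith
    have h3 : ∑ x ∈ S', π x * c (ε x) x * (f (σ (ε x) x) - f x) ^ 2 ≤
        2 * edgeEnergy σ c π f := by
      have hnn : ∀ e x, 0 ≤ π x * c e x * (f (σ e x) - f x) ^ 2 := fun e x =>
        mul_nonneg (mul_nonneg (hπ x).le (hc e x)) (sq_nonneg _)
      calc _ ≤ ∑ x ∈ S', ∑ e, π x * c e x * (f (σ e x) - f x) ^ 2 :=
            sum_le_sum fun x _ => single_le_sum
              (f := fun e => π x * c e x * (f (σ e x) - f x) ^ 2) (fun e _ => hnn e x) (mem_univ _)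
        _ ≤ ∑ x, ∑ e, π x * c e x * (f (σ e x) - f x) ^ 2 :=
            sum_le_sum_of_subset_of_nonneg (subset_univ _)
              fun x _ _ => sum_nonneg fun e _ => hnn e x
        _ = _ := by rw [sum_comm, edgeEnergy]; ring
    have h4 : ∑ x ∈ S', π (nx x) * f (nx x) ^ 2 ≤
        B * (1 + δ * M) * ∑ y ∈ T, π y * f y ^ 2 := by
      rw [← sum_fiberwise_of_maps_to (fun x hx => (hmem x hx).2), mul_sum]
      refine sum_le_sum fun y hy => ?_
      rw [sum_congr rfl (g := fun _ => π y * f y ^ 2)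
        (fun x hx => by rw [(mem_filter.1 hx).2]), sum_const, nsmul_eq_mul]
      refine mul_le_mul_of_nonneg_right ?_ (mul_nonneg (hπ y).le (sq_nonneg _))
      have hcard : (S'.filter fun x => nx x = y).card ≤
          (univ.filter fun e => D e (σ e y)).card := by
        refine card_le_card_of_injOn ε ?_ ?_
        · intro x hx
          obtain ⟨hxS, rfl⟩ := mem_filter.1 hx
          simp only [hnx, coe_filter, mem_univ, true_and, Set.mem_ofPred_eq, hσ]
          exact hε x (hmem x hxS).1
        · intro x hx x' hx' h
          have e1 : σ (ε x) x = y := (mem_filter.1 hx).2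
          have e2 : σ (ε x') x' = y := (mem_filter.1 hx').2
          rw [← hσ (ε x) x, e1, h, ← e2, hσ]
      have hy' := (mem_filter.1 hy).2
      calc ((S'.filter fun x => nx x = y).card : ℝ)
          ≤ ((univ.filter fun e => D e (σ e y)).card : ℝ) := by exact_mod_cast hcard
        _ ≤ B * V y := hcount y
        _ ≤ _ := by gcongr
    rw [h1]
    calc _ ≤ ∑ x ∈ S', (4 * (π x * c (ε x) x * (f (σ (ε x) x) - f x) ^ 2) +
            2 * (π (nx x) * f (nx x) ^ 2)) := sum_le_sum h2
      _ = 4 * ∑ x ∈ S', π x * c (ε x) x * (f (σ (ε x) x) - f x) ^ 2 +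
            2 * ∑ x ∈ S', π (nx x) * f (nx x) ^ 2 := by
          rw [sum_add_distrib, ← mul_sum, ← mul_sum]
      _ ≤ 4 * (2 * edgeEnergy σ c π f) +
            2 * (B * (1 + δ * M) * (levelConst δ B M * edgeEnergy σ c π f)) := by
          have : 0 ≤ B * (1 + δ * M) := by positivity
          have := mul_le_mul_of_nonneg_left ih this
          linarith
      _ = _ := by rw [levelConst]; ring

/-- A Lyapunov function implies a Poincaré inequality. -/
lemma poincare_of_lyapunov [DecidableEq Ω] [Nonempty E] (hσ : ∀ e x, σ e (σ e x) = x)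
    (hrev : ∀ e x, π x * c e x = π (σ e x) * c e (σ e x))
    (hπ : ∀ x, 0 < π x) (hπ1 : ∑ x, π x = 1) (hc : ∀ e x, 0 ≤ c e x)
    (hc1 : ∀ e x, c e x + c e (σ e x) ≤ 1) {V : Ω → ℝ} (hV : ∀ x, 1 ≤ V x)
    (hdrift : ∀ x, edgeGen σ c V x ≤ - (1 / 20) * V x + 1 / 4)
    (D : E → Ω → Prop) [∀ e x, Decidable (D e x)]
    (hD : ∀ e x, D e x → 1 / 2 ≤ c e x ∧ V (σ e x) ≤ V x - 1 / 100)
    (o : Ω) (hex : ∀ x, x ≠ o → ∃ e, D e x)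
    (hcount : ∀ y, ((univ.filter fun e => D e (σ e y)).card : ℝ) ≤ 100 * V y)
    {f : Ω → ℝ} (hf : ∑ x, π x * f x = 0) :
    ∑ x, π x * f x ^ 2 ≤ (40 + 9 * levelConst (1 / 100) 100 900) * edgeEnergy σ c π f := by
  set g : Ω → ℝ := fun x => f x - f o with hg
  have hgo : g o = 0 := sub_self _
  have hQ : edgeEnergy σ c π g = edgeEnergy σ c π f := by
    simp [edgeEnergy, hg]
  have h1 : ∑ x, π x * f x ^ 2 ≤ ∑ x, π x * g x ^ 2 := by
    have : ∑ x, π x * g x ^ 2 =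
        ∑ x, π x * f x ^ 2 - 2 * f o * ∑ x, π x * f x + f o ^ 2 * ∑ x, π x := by
      rw [mul_sum, mul_sum, ← sum_sub_distrib, ← sum_add_distrib]
      exact sum_congr rfl fun x _ => by simp only [hg]; ring
    rw [this, hf, hπ1]
    nlinarith [sq_nonneg (f o)]
  have h2 := sum_sq_mul_neg_edgeGen_div_le hσ hrev hπ hc (fun x => by linarith [hV x]) (V := V) g
  have h3 := sum_sublevel_sq_le hσ hrev hπ hc hc1 hV (by norm_num : (0 : ℝ) < 1 / 100)
    (by norm_num : (0 : ℝ) ≤ 100) D hD o hex hcount hgo 900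
  have h4 : ∀ x, (1 / 40) * (π x * g x ^ 2) ≤ π x * (g x ^ 2 * (- edgeGen σ c V x / V x)) +
      (9 / 40) * (if V x ≤ 1 + 1 / 100 * (900 : ℕ) then π x * g x ^ 2 else 0) := by
    intro x
    have hVx := hV x
    have hp : 0 ≤ π x * g x ^ 2 := mul_nonneg (hπ x).le (sq_nonneg _)
    have key : 1 / 20 - 1 / 4 / V x ≤ - edgeGen σ c V x / V x := by
      rw [le_div_iff₀ (by linarith), sub_mul, div_mul_cancel₀ _ (by linarith)]
      linarith [hdrift x]
    have : π x * (g x ^ 2 * (- edgeGen σ c V x / V x)) =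
      (π x * g x ^ 2) * (- edgeGen σ c V x / V x) := by ring
    rw [this]
    split_ifs with h
    · have : 1 / 4 / V x ≤ 1 / 4 := div_le_self (by norm_num) hVx
      nlinarith
    · push Not at h
      norm_num at h
      have : 1 / 4 / V x ≤ 1 / 40 := by
        rw [div_le_iff₀ (by linarith)]; linarith
      nlinarith
  have h5 := sum_le_sum fun x (_ : x ∈ (univ : Finset Ω)) => h4 x
  rw [sum_add_distrib, ← mul_sum, ← mul_sum, ← sum_filter] at h5
  rw [hQ] at h2 h3
  linarith

end Abstract

section Words

/-- The two positions `i < j` hold different letters and only `B`s lie strictly between them. -/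
def Act (w : ℕ → Fin 3) (i j : ℕ) : Prop :=
  i < j ∧ w i ≠ w j ∧ ∀ l, i < l → l < j → w l = 1

/-- Growth factor of a letter to the left of an `A`. -/
noncomputable def letterGrowth : Fin 3 → ℝ := ![1, 101 / 100, 5 / 4]

/-- Weight factor of a letter to the right of an `A`. -/
noncomputable def letterWeight : Fin 3 → ℝ := ![3 / 2, 1, 1]

/-- Product of the growth factors of the first `x` letters. -/
noncomputable def growth (w : ℕ → Fin 3) (x : ℕ) : ℝ := ∏ y ∈ range x, letterGrowth (w y)

/-- Product of the weight factors of the letters in positions `x + 1, …, n - 1`. -/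
noncomputable def weight (w : ℕ → Fin 3) (n x : ℕ) : ℝ :=
  ∏ y ∈ Ico (x + 1) n, letterWeight (w y)

/-- The potential measuring how far the letters `A` are from the left end. -/
noncomputable def potA (w : ℕ → Fin 3) (n : ℕ) : ℝ :=
  ∑ x ∈ range n, if w x = 0 then weight w n x * (growth w x - 1) else 0

lemma one_le_letterGrowth (l : Fin 3) : 1 ≤ letterGrowth l := by
  fin_cases l <;> norm_num [letterGrowth]

lemma one_le_letterWeight (l : Fin 3) : 1 ≤ letterWeight l := by
  fin_cases l <;> norm_num [letterWeight]

lemma letterWeight_of_ne {l : Fin 3} (h : l ≠ 0) : letterWeight l = 1 := by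
  fin_cases l
  · exact absurd rfl h
  · rfl
  · rfl

lemma letter_eq_two {l : Fin 3} (h0 : l ≠ 0) (h1 : l ≠ 1) : l = 2 := by omega

variable {w : ℕ → Fin 3} {n : ℕ}

lemma growth_succ (x : ℕ) : growth w (x + 1) = growth w x * letterGrowth (w x) :=
  prod_range_succ _ _

lemma growth_pos (x : ℕ) : 0 < growth w x :=
  prod_pos fun _ _ => lt_of_lt_of_le one_pos (one_le_letterGrowth _)

lemma growth_mono : Monotone (growth w) :=
  monotone_nat_of_le_succ fun x => by
    rw [growth_succ]
    exact le_mul_of_one_le_right (growth_pos x).le (one_le_letterGrowth _)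

lemma one_le_growth (x : ℕ) : 1 ≤ growth w x := by
  simpa [growth] using growth_mono (w := w) (Nat.zero_le x)

lemma one_le_weight (x : ℕ) : 1 ≤ weight w n x := by
  unfold weight
  exact one_le_prod fun _ _ => one_le_letterWeight _

lemma growth_succ_of_zero {x : ℕ} (h : w x = 0) : growth w (x + 1) = growth w x := by
  rw [growth_succ, h]; simp [letterGrowth]

lemma growth_succ_of_two {x : ℕ} (h : w x = 2) : growth w (x + 1) = 5 / 4 * growth w x := by
  rw [growth_succ, h]; simp [letterGrowth, mul_comm]

lemma growth_run {x : ℕ} (d : ℕ) (h : ∀ l, x ≤ l → l < x + d → w l = 1) :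
    growth w (x + d) = (101 / 100) ^ d * growth w x := by
  induction d with
  | zero => simp
  | succ d ih =>
    rw [← add_assoc, growth_succ, ih fun l h1 h2 => h l h1 (by omega),
      h (x + d) (by omega) (by omega), pow_succ]
    simp [letterGrowth]; ring

lemma potA_nonneg : 0 ≤ potA w n :=
  sum_nonneg fun x _ => by
    split_ifs
    · exact mul_nonneg (by linarith [one_le_weight (w := w) (n := n) x])
        (by linarith [one_le_growth (w := w) x])
    · exact le_rfl

/-- Rate bounds for the moves of a letter `A`. -/
structure RateBounds (w : ℕ → Fin 3) (r : ℕ → ℕ → ℝ) : Prop where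
  nonneg : ∀ i j, 0 ≤ r i j
  inactive : ∀ i j, ¬ Act w i j → r i j = 0
  right_one : ∀ i d, w i = 0 → w (i + d) = 1 → r i (i + d) ≤ 1 / (1 + 2 ^ d)
  right_two : ∀ i d, w i = 0 → w (i + d) = 2 → r i (i + d) ≤ 1 / (1 + 4 ^ d)
  left_one : ∀ i d, Act w i (i + d) → w i = 1 → w (i + d) = 0 → 2 ^ d / (1 + 2 ^ d) ≤ r i (i + d)
  left_two : ∀ i d, Act w i (i + d) → w i = 2 → w (i + d) = 0 → 4 / 5 ≤ r i (i + d)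

/-- Rate of increase of the potential through right moves of an `A` in position `k`. -/
noncomputable def rightGain (w : ℕ → Fin 3) (n : ℕ) (r : ℕ → ℕ → ℝ) (k : ℕ) : ℝ :=
  ∑ j ∈ Ico (k + 1) n, r k j * (growth w (j + 1) - growth w k)

/-- Rate of decrease of the potential through left moves of an `A` in position `k`. -/
noncomputable def leftLoss (w : ℕ → Fin 3) (r : ℕ → ℕ → ℝ) (k : ℕ) : ℝ :=
  ∑ i ∈ range k, r i k * (growth w k - growth w i)

variable {r : ℕ → ℕ → ℝ}

lemma le_leftLoss (hr : RateBounds w r) {i k : ℕ} (hik : i < k) :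
    r i k * (growth w k - growth w i) ≤ leftLoss w r k :=
  single_le_sum (f := fun i => r i k * (growth w k - growth w i))
    (fun l hl => mul_nonneg (hr.nonneg l k)
      (sub_nonneg.2 (growth_mono (mem_range.1 hl).le))) (mem_range.2 hik)

lemma leftLoss_of_two (hr : RateBounds w r) {m k : ℕ} (hmk : m < k) (hm : w m = 2) (hk : w k = 0)
    (hB : ∀ l, m < l → l < k → w l = 1) :
    16 / 100 * growth w k ≤ leftLoss w r k := by
  obtain ⟨d, rfl⟩ := Nat.exists_eq_add_of_lt hmk
  have h1 := le_leftLoss hr hmk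
  have h2 := hr.left_two m (d + 1) ⟨by omega, by rw [hm, ← add_assoc, hk]; decide, hB⟩ hm hk
  have h3 := growth_mono (w := w) (show m + 1 ≤ m + d + 1 by omega)
  rw [growth_succ_of_two hm] at h3
  have h4 := growth_pos (w := w) m
  rw [← add_assoc] at h2
  nlinarith

/-- Either everything in `[p, k)` is a `B`, or there is a last letter which is not. -/
lemma run_or_last (w : ℕ → Fin 3) (p k : ℕ) :
    (∀ l, p ≤ l → l < k → w l = 1) ∨
      ∃ m, p ≤ m ∧ m < k ∧ w m ≠ 1 ∧ ∀ l, m < l → l < k → w l = 1 := by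
  induction k with
  | zero => left; intro l _ h; omega
  | succ k ih =>
    by_cases hk : w k = 1
    · rcases ih with h | ⟨m, h1, h2, h3, h4⟩
      · left
        intro l h1 h2
        rcases Nat.lt_succ_iff_lt_or_eq.1 h2 with h3 | rfl
        · exact h l h1 h3
        · exact hk
      · right
        refine ⟨m, h1, by omega, h3, fun l h5 h6 => ?_⟩
        rcases Nat.lt_succ_iff_lt_or_eq.1 h6 with h | rfl
        · exact h4 l h5 h
        · exact hk
    · by_cases hpk : p ≤ k
      · right; exact ⟨k, hpk, by omega, hk, fun l h5 h6 => by omega⟩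
      · left; intro l h1 h2; omega

lemma first_or_run (w : ℕ → Fin 3) (p k : ℕ) :
    (∀ l, p ≤ l → l < k → w l = 1) ∨
      ∃ m, p ≤ m ∧ m < k ∧ w m ≠ 1 ∧ ∀ l, p ≤ l → l < m → w l = 1 := by
  by_cases h : ∃ m, p ≤ m ∧ m < k ∧ w m ≠ 1
  · right
    classical
    have hs := Nat.find_spec h
    refine ⟨Nat.find h, hs.1, hs.2.1, hs.2.2, fun l h1 h2 => ?_⟩
    by_contra h3
    exact Nat.find_min h h2 ⟨h1, by omega, h3⟩
  · left
    push Not at h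
    exact h

lemma leftLoss_first (hr : RateBounds w r) {k : ℕ} (hk : w k = 0) (h0 : ∀ i < k, w i ≠ 0) :
    15 / 100 * (growth w k - 1) ≤ leftLoss w r k := by
  have hU := one_le_growth (w := w) k
  rcases run_or_last w 0 k with h | ⟨m, -, h2, h3, h4⟩
  · rcases Nat.eq_zero_or_pos k with rfl | hpos
    · simp [growth, leftLoss]
    · have h1 := le_leftLoss hr hpos
      have hw0 := h 0 le_rfl hpos
      have h2 := hr.left_one 0 k (by
        rw [zero_add]
        exact ⟨hpos, by rw [hw0, hk]; decide, fun l _ hl => h l (by omega) hl⟩) hw0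
        (by rw [zero_add, hk])
      rw [zero_add] at h2
      have h3 : (2 / 3 : ℝ) ≤ 2 ^ k / (1 + 2 ^ k) := by
        rw [div_le_div_iff₀ (by norm_num) (by positivity)]
        have : (2 : ℝ) ≤ 2 ^ k := by
          simpa using pow_le_pow_right₀ (one_le_two (α := ℝ)) hpos
        linarith
      have h4 : growth w 0 = 1 := by simp [growth]
      rw [h4] at h1
      nlinarith
  · have := leftLoss_of_two hr h2 (letter_eq_two (h0 m h2) h3) hk h4
    linarith

lemma hop_sum_le (D : ℕ) :
    ∑ d ∈ range D, (1 / 2 : ℝ) ^ (d + 1) * ((101 / 100) ^ (d + 1) - 1) ≤ 2 / 99 := by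
  have h : ∑ d ∈ range D, (1 / 2 : ℝ) ^ (d + 1) * ((101 / 100) ^ (d + 1) - 1) =
      2 / 99 - 101 / 99 * ((1 / 2) ^ D * (101 / 100) ^ D) + (1 / 2) ^ D := by
    induction D with
    | zero => norm_num
    | succ D ih => rw [sum_range_succ, ih]; ring
  rw [h]
  have h1 : (1 : ℝ) ≤ (101 / 100) ^ D := one_le_pow₀ (by norm_num)
  have h2 : (0 : ℝ) < (1 / 2) ^ D := by positivity
  nlinarith

lemma jump_bound (h : ℕ) : (5 / 4 : ℝ) * (101 / 100) ^ h - 1 ≤ 4 ^ h / 4 := by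
  induction h with
  | zero => norm_num
  | succ h ih =>
    have : (1 : ℝ) ≤ 4 ^ h := one_le_pow₀ (by norm_num)
    rw [pow_succ, pow_succ]
    linarith

/-- Contribution of the hops over a run of `B`s to the right. -/
lemma hop_part_le (hr : RateBounds w r) {k m : ℕ} (hk : w k = 0)
    (hB : ∀ l, k + 1 ≤ l → l < m → w l = 1) :
    ∑ j ∈ Ico (k + 1) m, r k j * (growth w (j + 1) - growth w k) ≤ 2 / 99 * growth w k := by
  have hpos := growth_pos (w := w) k
  rw [sum_Ico_eq_sum_range]
  calc _ ≤ ∑ d ∈ range (m - (k + 1)),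
        (1 / 2 : ℝ) ^ (d + 1) * ((101 / 100) ^ (d + 1) - 1) * growth w k := by
        refine sum_le_sum fun d hd => ?_
        have hd' := mem_range.1 hd
        have e1 : growth w (k + 1 + d + 1) = (101 / 100) ^ (d + 1) * growth w k := by
          rw [add_assoc (k + 1), growth_run (d + 1) (fun l h1 h2 => hB l h1 (by omega)),
            growth_succ_of_zero hk]
        have e2 := hr.right_one k (1 + d) hk (hB _ (by omega) (by omega))
        have e3 : (1 : ℝ) / (1 + 2 ^ (1 + d)) ≤ (1 / 2) ^ (d + 1) := by
          rw [div_pow, one_pow, add_comm d 1]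
          gcongr
          linarith
        have e4 : (1 : ℝ) ≤ (101 / 100) ^ (d + 1) := one_le_pow₀ (by norm_num)
        rw [e1, ← sub_one_mul, ← mul_assoc, add_assoc]
        refine mul_le_mul_of_nonneg_right ?_ hpos.le
        exact mul_le_mul_of_nonneg_right (e2.trans e3) (by linarith)
    _ ≤ _ := by
        rw [← sum_mul]
        exact mul_le_mul_of_nonneg_right (hop_sum_le _) hpos.le

lemma rightGain_le (hr : RateBounds w r) {k : ℕ} (hk : w k = 0) :
    rightGain w n r k ≤ 9 / 100 * growth w k := by
  have hpos := growth_pos (w := w) k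
  unfold rightGain
  rcases first_or_run w (k + 1) n with h | ⟨m, h1, h2, h3, h4⟩
  · have := hop_part_le hr hk h
    linarith
  · have hhop := hop_part_le hr hk h4
    rw [← sum_Ico_consecutive _ h1 h2.le, sum_eq_sum_Ico_succ_bot h2]
    have hz : ∑ j ∈ Ico (m + 1) n, r k j * (growth w (j + 1) - growth w k) = 0 := by
      refine sum_eq_zero fun j hj => ?_
      rw [hr.inactive, zero_mul]
      rintro ⟨-, -, h⟩
      exact h3 (h m (by omega) (by have := mem_Ico.1 hj; omega))
    rw [hz]
    have hm : r k m * (growth w (m + 1) - growth w k) ≤ 1 / 16 * growth w k := by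
      by_cases hm0 : w m = 0
      · rw [hr.inactive, zero_mul]
        · positivity
        · rintro ⟨-, h, -⟩; exact h (hk.trans hm0.symm)
      · have hm2 := letter_eq_two hm0 h3
        obtain ⟨d, rfl⟩ := Nat.exists_eq_add_of_le h1
        have e1 : growth w (k + 1 + d + 1) = 5 / 4 * (101 / 100) ^ d * growth w k := by
          rw [growth_succ_of_two hm2, growth_run d (fun l h1 h2 => h4 l h1 (by omega)),
            growth_succ_of_zero hk]; ring
        have e2 := hr.right_two k (1 + d) hk (by rw [← add_assoc]; exact hm2)
        rw [← add_assoc] at e2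
        have e3 : (1 : ℝ) / (1 + 4 ^ (1 + d)) * (4 ^ d / 4) ≤ 1 / 16 := by
          rw [div_mul_eq_mul_div, div_le_div_iff₀ (by positivity) (by norm_num), pow_add]
          have : (0 : ℝ) < 4 ^ d := by positivity
          linarith
        have e5 : (1 : ℝ) ≤ (101 / 100) ^ d := one_le_pow₀ (by norm_num)
        rw [e1, ← sub_one_mul, ← mul_assoc]
        refine mul_le_mul_of_nonneg_right ?_ hpos.le
        refine le_trans (mul_le_mul e2 (jump_bound d) (by linarith) (by positivity)) e3
    linarith

lemma leftLoss_sub_rightGain (hr : RateBounds w r) {p k : ℕ} (hpk : p < k) (hkn : k < n)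
    (hp : w p = 0) (hk : w k = 0) (h0 : ∀ i, p < i → i < k → w i ≠ 0) :
    15 / 100 * (growth w k - growth w p) ≤ leftLoss w r k - 3 / 2 * rightGain w n r p := by
  have hpos := growth_pos (w := w) p
  rcases run_or_last w (p + 1) k with h | ⟨m, h1, h2, h3, h4⟩
  · obtain ⟨D, rfl⟩ := Nat.exists_eq_add_of_lt hpk
    have hR : rightGain w n r p =
        ∑ d ∈ range D, r p (p + 1 + d) * (growth w (p + 1 + d + 1) - growth w p) := by
      unfold rightGain
      rw [← sum_Ico_consecutive _ (show p + 1 ≤ p + D + 1 by omega) hkn.le,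
        sum_Ico_eq_sum_range, show p + D + 1 - (p + 1) = D by omega, add_eq_left]
      refine sum_eq_zero fun j hj => ?_
      rw [hr.inactive, zero_mul]
      rintro ⟨-, h5, h6⟩
      have hj' := (mem_Ico.1 hj).1
      rcases hj'.eq_or_lt with e | hlt
      · exact h5 (by rw [← e, hp, hk])
      · have := h6 (p + D + 1) (by omega) hlt
        rw [hk] at this
        exact absurd this (by decide)
    have hL : ∑ d ∈ range D, r (p + D - d) (p + D + 1) *
        (growth w (p + D + 1) - growth w (p + D - d)) ≤ leftLoss w r (p + D + 1) := by
      have : ∑ d ∈ range D, r (p + D - d) (p + D + 1) *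
        (growth w (p + D + 1) - growth w (p + D - d)) = ∑ i ∈ Ico (p + 1) (p + D + 1),
          r i (p + D + 1) * (growth w (p + D + 1) - growth w i) := by
        rw [sum_Ico_eq_sum_range, show p + D + 1 - (p + 1) = D by omega, ← sum_range_reflect]
        refine sum_congr rfl fun d hd => ?_
        have := mem_range.1 hd
        rw [show p + D - (D - 1 - d) = p + 1 + d by omega]
      rw [this]
      refine sum_le_sum_of_subset_of_nonneg (fun i hi => ?_) fun i hi _ => ?_
      · exact mem_range.2 (mem_Ico.1 hi).2
      · exact mul_nonneg (hr.nonneg _ _) (sub_nonneg.2 (growth_mono (mem_range.1 hi).le))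
    have hrun : ∀ d ≤ D, growth w (p + 1 + d) = (101 / 100) ^ d * growth w p := by
      intro d hd
      rw [growth_run d (fun l h1 h2 => h l h1 (by omega)), growth_succ_of_zero hp]
    have hgk : growth w (p + D + 1) = (101 / 100) ^ D * growth w p := by
      rw [← hrun D le_rfl]; congr 1; omega
    have hterm : ∀ d ∈ range D, 1 / 6 * (growth w (p + 1 + (d + 1)) - growth w p) ≤
        r (p + D - d) (p + D + 1) * (growth w (p + D + 1) - growth w (p + D - d)) -
          3 / 2 * (r p (p + 1 + d) * (growth w (p + 1 + d + 1) - growth w p)) := by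
      intro d hd
      have hd' := mem_range.1 hd
      obtain ⟨e, rfl⟩ := Nat.exists_eq_add_of_lt hd'
      have i1 : p + (d + e + 1) - d = p + 1 + e := by omega
      have i2 : p + (d + e + 1) + 1 = p + 1 + e + (d + 1) := by omega
      have a1 := hr.left_one (p + 1 + e) (d + 1) ⟨by omega, by
          rw [h (p + 1 + e) (by omega) (by omega), ← i2, hk]; decide,
          fun l h1 h2 => h l (by omega) (by omega)⟩ (h _ (by omega) (by omega)) (by rw [← i2, hk])
      have a2 := hr.right_one p (1 + d) hp (h _ (by omega) (by omega))
      rw [add_comm 1 d] at a2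
      rw [hgk, i1, i2, hrun e (by omega), add_assoc (p + 1) d 1, hrun (d + 1) (by omega)]
      set φ : ℝ := 1 / (1 + 2 ^ (d + 1)) with hφ
      have hφ' : (2 : ℝ) ^ (d + 1) / (1 + 2 ^ (d + 1)) = 1 - φ := by
        rw [hφ]; field_simp; ring
      have hφ3 : φ ≤ 1 / 3 := by
        rw [hφ, div_le_div_iff₀ (by positivity) (by norm_num), pow_succ]
        have : (1 : ℝ) ≤ 2 ^ d := one_le_pow₀ (by norm_num)
        linarith
      rw [hφ'] at a1
      have b1 : (1 : ℝ) ≤ (101 / 100) ^ (d + 1) := one_le_pow₀ (by norm_num)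
      have b2 : (1 : ℝ) ≤ (101 / 100) ^ e := one_le_pow₀ (by norm_num)
      set x : ℝ := (101 / 100) ^ (d + 1) * growth w p - growth w p with hx
      have hx0 : 0 ≤ x := by rw [hx]; nlinarith
      have c1 : (101 / 100 : ℝ) ^ (d + e + 1) * growth w p - (101 / 100) ^ e * growth w p =
          (101 / 100) ^ e * x := by rw [hx]; ring
      rw [c1]
      have c2 : x ≤ (101 / 100) ^ e * x := le_mul_of_one_le_left hx0 b2
      have c3 : (1 - φ) * x ≤ r (p + 1 + e) (p + 1 + e + (d + 1)) * ((101 / 100) ^ e * x) :=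
        mul_le_mul a1 c2 hx0 (hr.nonneg _ _)
      have c4 : r p (p + (d + 1)) * x ≤ φ * x := mul_le_mul_of_nonneg_right a2 hx0
      have c5 : p + 1 + d = p + (d + 1) := by omega
      rw [c5]
      nlinarith
    have hsum := sum_le_sum hterm
    rw [sum_sub_distrib, ← mul_sum, ← mul_sum, ← hR] at hsum
    have hlast : growth w (p + D + 1) - growth w p ≤
        ∑ d ∈ range D, (growth w (p + 1 + (d + 1)) - growth w p) := by
      rcases Nat.eq_zero_or_pos D with rfl | hD
      · simp [growth_succ_of_zero hp]
      · obtain ⟨e, rfl⟩ := Nat.exists_eq_add_of_lt hD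
        refine le_trans (le_of_eq ?_) (single_le_sum
          (f := fun d => growth w (p + 1 + (d + 1)) - growth w p)
          (fun d _ => sub_nonneg.2 (growth_mono (by omega))) (mem_range.2 (show e < 0 + e + 1 by omega)))
        congr 2; omega
    have := growth_mono (w := w) hpk.le
    linarith
  · have hm := letter_eq_two (h0 m (by omega) h2) h3
    have b1 := leftLoss_of_two hr h2 hm hk h4
    have b2 := rightGain_le (n := n) hr hp
    have b3 := growth_mono (w := w) hpk.le
    linarith

lemma weight_eq_of_consecutive {p k : ℕ} (hpk : p < k) (hkn : k < n) (hk : w k = 0)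
    (h0 : ∀ i, p < i → i < k → w i ≠ 0) : weight w n p = 3 / 2 * weight w n k := by
  unfold weight
  rw [← prod_Ico_consecutive _ (show p + 1 ≤ k by omega) hkn.le, prod_eq_prod_Ico_succ_bot hkn,
    prod_eq_one fun i hi => letterWeight_of_ne (h0 i (by have := mem_Ico.1 hi; omega)
      (mem_Ico.1 hi).2), hk]
  simp [letterWeight]

/-- The drift of the potential. -/
lemma potA_drift_aux (hr : RateBounds w r) (p : ℕ) (hp : p ≤ n) :
    ((∀ k < p, w k ≠ 0) ∨ ∃ q < p, w q = 0 ∧ (∀ k, q < k → k < p → w k ≠ 0) ∧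
      ∑ k ∈ range p, (if w k = 0 then weight w n k * (rightGain w n r k - leftLoss w r k) else 0)
        - weight w n q * rightGain w n r q ≤
      - (15 / 100) * (2 / 3 * (weight w n q * (growth w q - 1)) + 1 / 3 *
        ∑ k ∈ range p, if w k = 0 then weight w n k * (growth w k - 1) else 0)) := by
  induction p with
  | zero => left; intro k hk; omega
  | succ p ih =>
    by_cases hw : w p = 0
    · right
      refine ⟨p, by omega, hw, fun k h1 h2 => by omega, ?_⟩
      rw [sum_range_succ, sum_range_succ, if_pos hw, if_pos hw]
      have ha := one_le_weight (w := w) (n := n) p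
      rcases ih (by omega) with h | ⟨q, hq, hwq, hz, hs⟩
      · rw [sum_eq_zero fun k hk => if_neg (h k (mem_range.1 hk)),
          sum_eq_zero fun k hk => if_neg (h k (mem_range.1 hk))]
        have := leftLoss_first hr hw h
        have := mul_le_mul_of_nonneg_left this (by linarith : 0 ≤ weight w n p)
        linarith
      · have h1 := leftLoss_sub_rightGain hr hq (show p < n by omega) hwq hw hz
        have h2 := mul_le_mul_of_nonneg_left h1 (by linarith : 0 ≤ weight w n p)
        rw [weight_eq_of_consecutive hq (show p < n by omega) hw hz] at hs
        linarith
    · rw [sum_range_succ, sum_range_succ, if_neg hw, if_neg hw, add_zero, add_zero]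
      rcases ih (by omega) with h | ⟨q, hq, hwq, hz, hs⟩
      · left
        intro k hk
        rcases Nat.lt_succ_iff_lt_or_eq.1 hk with h' | rfl
        · exact h k h'
        · exact hw
      · right
        refine ⟨q, by omega, hwq, fun k h1 hk => ?_, hs⟩
        rcases Nat.lt_succ_iff_lt_or_eq.1 hk with h' | rfl
        · exact hz k h1 h'
        · exact hw

lemma potA_drift_sum_le (hr : RateBounds w r) :
    ∑ k ∈ range n, (if w k = 0 then weight w n k * (rightGain w n r k - leftLoss w r k) else 0) ≤
      - (1 / 20) * potA w n + 1 / 10 := by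
  rcases potA_drift_aux hr n le_rfl with h | ⟨q, hq, hwq, hz, hs⟩
  · unfold potA
    rw [sum_eq_zero fun k hk => if_neg (h k (mem_range.1 hk)),
      sum_eq_zero fun k hk => if_neg (h k (mem_range.1 hk))]
    norm_num
  · have h1 : weight w n q = 1 := by
      unfold weight
      exact prod_eq_one fun i hi => letterWeight_of_ne (hz i (by have := mem_Ico.1 hi; omega)
        (mem_Ico.1 hi).2)
    rw [h1] at hs
    have h2 := rightGain_le (n := n) hr hwq
    have h3 := one_le_growth (w := w) q
    unfold potA
    linarith

end Words

section Moves

variable {w w' : ℕ → Fin 3} {n : ℕ}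

lemma Act.swap {i j : ℕ} (h : Act w i j) : Act (w ∘ Equiv.swap i j) i j := by
  refine ⟨h.1, ?_, fun l h1 h2 => ?_⟩
  · simpa using h.2.1.symm
  · simp only [Function.comp_apply, Equiv.swap_apply_of_ne_of_ne h1.ne' h2.ne]
    exact h.2.2 l h1 h2

lemma swap_comp_swap (w : ℕ → Fin 3) (i j : ℕ) :
    (w ∘ Equiv.swap i j) ∘ Equiv.swap i j = w := by
  funext x; simp

lemma growth_congr {x : ℕ} (h : ∀ y < x, w y = w' y) : growth w x = growth w' x :=
  prod_congr rfl fun y hy => by rw [h y (mem_range.1 hy)]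

lemma weight_congr {x : ℕ} (h : ∀ y < n, x < y → w y = w' y) : weight w n x = weight w' n x :=
  prod_congr rfl fun y hy => by
    have := mem_Ico.1 hy
    rw [h y this.2 (by omega)]

lemma potA_congr (h : ∀ y < n, w y = w' y) : potA w n = potA w' n :=
  sum_congr rfl fun x hx => by
    have hx' := mem_range.1 hx
    rw [h x hx', weight_congr fun y hy _ => h y hy, growth_congr fun y hy => h y (hy.trans hx')]

lemma growth_swap_of_le {i j x : ℕ} (hij : i < j) (hx : x ≤ i) :
    growth (w ∘ Equiv.swap i j) x = growth w x :=
  growth_congr fun y hy => by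
    rw [Function.comp_apply, Equiv.swap_apply_of_ne_of_ne (by omega) (by omega)]

lemma growth_swap_of_lt {i j x : ℕ} (hij : i < j) (hx : j < x) :
    growth (w ∘ Equiv.swap i j) x = growth w x := by
  refine prod_equiv (Equiv.swap i j) (fun y => ?_) (fun y _ => rfl)
  simp only [mem_range]
  by_cases h1 : y = i
  · subst h1; rw [Equiv.swap_apply_left]; omega
  · by_cases h2 : y = j
    · subst h2; rw [Equiv.swap_apply_right]; omega
    · rw [Equiv.swap_apply_of_ne_of_ne h1 h2]

lemma weight_swap_of_le {i j x : ℕ} (hij : i < j) (hx : j ≤ x) :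
    weight (w ∘ Equiv.swap i j) n x = weight w n x :=
  weight_congr fun y _ hy => by
    rw [Function.comp_apply, Equiv.swap_apply_of_ne_of_ne (by omega) (by omega)]

lemma weight_swap_of_lt {i j x : ℕ} (hij : i < j) (hjn : j < n) (hx : x < i) :
    weight (w ∘ Equiv.swap i j) n x = weight w n x := by
  refine prod_equiv (Equiv.swap i j) (fun y => ?_) (fun y _ => rfl)
  simp only [mem_Ico]
  by_cases h1 : y = i
  · subst h1; rw [Equiv.swap_apply_left]; omega
  · by_cases h2 : y = j
    · subst h2; rw [Equiv.swap_apply_right]; omega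
    · rw [Equiv.swap_apply_of_ne_of_ne h1 h2]

lemma weight_eq_of_forall_ne {i j : ℕ} (hij : i ≤ j) (hjn : j < n)
    (h : ∀ l, i < l → l ≤ j → w l ≠ 0) : weight w n i = weight w n j := by
  unfold weight
  rw [← prod_Ico_consecutive _ (show i + 1 ≤ j + 1 by omega) (show j + 1 ≤ n by omega),
    prod_eq_one fun l hl => letterWeight_of_ne (h l (by have := mem_Ico.1 hl; omega)
      (by have := mem_Ico.1 hl; omega)), one_mul]

/-- The summand of the potential. -/
noncomputable def potTerm (w : ℕ → Fin 3) (n x : ℕ) : ℝ :=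
  if w x = 0 then weight w n x * (growth w x - 1) else 0

lemma potTerm_swap {i j x : ℕ} (h : Act w i j) (hjn : j < n) (hi : x ≠ i) (hj : x ≠ j) :
    potTerm (w ∘ Equiv.swap i j) n x = potTerm w n x := by
  unfold potTerm
  have e : (w ∘ Equiv.swap i j) x = w x := by
    rw [Function.comp_apply, Equiv.swap_apply_of_ne_of_ne hi hj]
  rw [e]
  rcases lt_or_gt_of_ne hi with h1 | h1
  · rw [growth_swap_of_le h.1 h1.le, weight_swap_of_lt h.1 hjn h1]
  · rcases lt_or_gt_of_ne hj with h2 | h2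
    · rw [h.2.2 x h1 h2]; simp
    · rw [growth_swap_of_lt h.1 h2, weight_swap_of_le h.1 h2.le]

lemma potA_swap_sub {i j : ℕ} (h : Act w i j) (hjn : j < n) :
    potA (w ∘ Equiv.swap i j) n - potA w n =
      (potTerm (w ∘ Equiv.swap i j) n i + potTerm (w ∘ Equiv.swap i j) n j) -
        (potTerm w n i + potTerm w n j) := by
  have key : ∀ u : ℕ → Fin 3, potA u n = (potTerm u n i + potTerm u n j) +
      ∑ x ∈ (range n \ {i, j}), potTerm u n x := by
    intro u
    rw [← sum_pair h.1.ne, add_comm, sum_sdiff]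
    · rfl
    · intro x hx
      have := h.1
      simp only [mem_insert, mem_singleton] at hx
      rw [mem_range]; omega
  rw [key, key w, sum_congr rfl fun x hx => potTerm_swap h hjn (x := x) ?_ ?_]
  · ring
  · rintro rfl; simp at hx
  · rintro rfl; simp at hx

lemma potA_swap_of_left {i j : ℕ} (h : Act w i j) (hjn : j < n) (hi : w i = 0) :
    potA (w ∘ Equiv.swap i j) n - potA w n =
      weight w n i * (growth w (j + 1) - growth w i) := by
  rw [potA_swap_sub h hjn]
  have hj : w j ≠ 0 := fun e => h.2.1 (hi.trans e.symm)
  have e1 : (w ∘ Equiv.swap i j) i = w j := by simp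
  have e2 : (w ∘ Equiv.swap i j) j = w i := by simp
  unfold potTerm
  rw [e1, e2, if_neg hj, if_pos hi, if_pos hi, if_neg hj, weight_swap_of_le h.1 le_rfl,
    ← growth_succ_of_zero (e2.trans hi), growth_swap_of_lt h.1 (by omega),
    weight_eq_of_forall_ne h.1.le hjn]
  · ring
  · intro l h1 h2
    rcases h2.eq_or_lt with rfl | h2
    · exact hj
    · rw [h.2.2 l h1 h2]; decide

lemma potA_swap_of_right {i j : ℕ} (h : Act w i j) (hjn : j < n) (hj : w j = 0) :
    potA (w ∘ Equiv.swap i j) n - potA w n = - (weight w n j * (growth w j - growth w i)) := by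
  have h1 := potA_swap_of_left h.swap hjn (by simpa using hj)
  have hi : w i ≠ 0 := fun e => h.2.1 (e.trans hj.symm)
  rw [swap_comp_swap, growth_swap_of_lt h.1 (by omega), growth_swap_of_le h.1 le_rfl,
    growth_succ_of_zero hj, weight_eq_of_forall_ne h.1.le hjn, weight_swap_of_le h.1 le_rfl] at h1
  · linarith
  · intro l h1 h2
    rcases h2.eq_or_lt with rfl | h2
    · simpa using hi
    · rw [h.swap.2.2 l h1 h2]; decide

lemma potA_swap_of_ne {i j : ℕ} (h : Act w i j) (hjn : j < n) (hi : w i ≠ 0) (hj : w j ≠ 0) :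
    potA (w ∘ Equiv.swap i j) n - potA w n = 0 := by
  rw [potA_swap_sub h hjn]
  simp [potTerm, hi, hj]

/-- Sum over the pairs `i < j` of positions. -/
noncomputable def pairSum (n : ℕ) (F : ℕ → ℕ → ℝ) : ℝ :=
  ∑ i ∈ range n, ∑ j ∈ range n, if i < j then F i j else 0

lemma pairSum_congr {F G : ℕ → ℕ → ℝ} (h : ∀ i j, i < j → j < n → F i j = G i j) :
    pairSum n F = pairSum n G :=
  sum_congr rfl fun i _ => sum_congr rfl fun j hj => by
    split_ifs with hij
    · exact h i j hij (mem_range.1 hj)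
    · rfl

lemma pairSum_reflect (F : ℕ → ℕ → ℝ) :
    pairSum n (fun i j => F (n - 1 - j) (n - 1 - i)) = pairSum n F := by
  unfold pairSum
  rw [sum_comm, ← sum_range_reflect]
  refine sum_congr rfl fun i hi => ?_
  rw [← sum_range_reflect]
  refine sum_congr rfl fun j hj => ?_
  have hi' := mem_range.1 hi
  have hj' := mem_range.1 hj
  beta_reduce
  rw [show n - 1 - (n - 1 - i) = i by omega, show n - 1 - (n - 1 - j) = j by omega]
  exact if_congr (by omega) rfl rfl

lemma pairSum_potA_le {r : ℕ → ℕ → ℝ} (hr : RateBounds w r) :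
    pairSum n (fun i j => r i j * (potA (w ∘ Equiv.swap i j) n - potA w n)) ≤
      - (1 / 20) * potA w n + 1 / 10 := by
  refine le_trans (le_of_eq ?_) (potA_drift_sum_le hr)
  have h1 : ∀ i j, i < j → j < n → r i j * (potA (w ∘ Equiv.swap i j) n - potA w n) =
      (if w i = 0 then weight w n i * (r i j * (growth w (j + 1) - growth w i)) else 0) -
        (if w j = 0 then weight w n j * (r i j * (growth w j - growth w i)) else 0) := by
    intro i j hij hjn
    by_cases h : Act w i j
    · by_cases hi : w i = 0
      · have hj : w j ≠ 0 := fun e => h.2.1 (hi.trans e.symm)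
        rw [potA_swap_of_left h hjn hi, if_pos hi, if_neg hj]; ring
      · by_cases hj : w j = 0
        · rw [potA_swap_of_right h hjn hj, if_neg hi, if_pos hj]; ring
        · rw [potA_swap_of_ne h hjn hi hj, if_neg hi, if_neg hj]; ring
    · simp [hr.inactive i j h]
  rw [pairSum_congr h1]
  have h2 : ∀ k ∈ range n,
      (if w k = 0 then weight w n k * (rightGain w n r k - leftLoss w r k) else 0) =
      (∑ j ∈ range n, if k < j then
        (if w k = 0 then weight w n k * (r k j * (growth w (j + 1) - growth w k)) else 0) else 0) -
      ∑ i ∈ range n, if i < k then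
        (if w k = 0 then weight w n k * (r i k * (growth w k - growth w i)) else 0) else 0 := by
    intro k hk
    have hk' := mem_range.1 hk
    by_cases hw : w k = 0
    · simp only [hw, if_true]
      rw [← sum_filter, ← sum_filter, ← mul_sum, ← mul_sum, ← mul_sub]
      congr 2
      · refine sum_congr ?_ fun _ _ => rfl
        ext j; simp only [mem_Ico, mem_filter, mem_range]; omega
      · refine sum_congr ?_ fun _ _ => rfl
        ext j; simp only [mem_filter, mem_range]; omega
    · simp [hw]
  rw [sum_congr rfl h2, sum_sub_distrib]
  unfold pairSum
  conv_rhs => rw [sum_comm (s := range n) (t := range n) (f := fun x i => if i < x then _ else _)]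
  rw [← sum_sub_distrib]
  refine sum_congr rfl fun i _ => ?_
  rw [← sum_sub_distrib]
  refine sum_congr rfl fun j _ => ?_
  beta_reduce
  split_ifs <;> ring

open Classical in
/-- Rate at which an active pair of positions is exchanged. -/
noncomputable def rate (s : Fin 3 → ℝ) (w : ℕ → Fin 3) (i j : ℕ) : ℝ :=
  if Act w i j then s (w i) ^ (j - i) / (s (w i) ^ (j - i) + s (w j) ^ (j - i)) else 0

/-- Successive strengths differ by a factor at least two. -/
structure Spread (s : Fin 3 → ℝ) : Prop where
  pos : 0 < s 0
  one : 2 * s 0 ≤ s 1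
  two : 2 * s 1 ≤ s 2

variable {s : Fin 3 → ℝ}

lemma Spread.pos_all (hs : Spread s) (l : Fin 3) : 0 < s l := by
  have h0 := hs.pos
  have h1 := hs.one
  have h2 := hs.two
  fin_cases l
  · exact h0
  · show 0 < s 1; linarith
  · show 0 < s 2; linarith

lemma Spread.strictMono (hs : Spread s) : StrictMono s := by
  have h0 := hs.pos
  have h1 := hs.one
  have h2 := hs.two
  refine Fin.strictMono_iff_lt_succ.2 fun i => ?_
  fin_cases i
  · show s 0 < s 1; linarith
  · show s 1 < s 2; linarith

lemma div_add_le {x y K : ℝ} (hx : 0 < x) (hK : 0 ≤ K) (h : K * x ≤ y) :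
    x / (x + y) ≤ 1 / (1 + K) := by
  rw [div_le_div_iff₀ (by nlinarith) (by linarith)]
  nlinarith

lemma le_div_add {x y K : ℝ} (hx : 0 < x) (hK : 0 ≤ K) (h : K * x ≤ y) (hy : 0 < y) :
    K / (1 + K) ≤ y / (y + x) := by
  rw [div_le_div_iff₀ (by linarith) (by linarith)]
  nlinarith

lemma rate_of_act {i j : ℕ} (h : Act w i j) :
    rate s w i j = s (w i) ^ (j - i) / (s (w i) ^ (j - i) + s (w j) ^ (j - i)) := if_pos h

lemma rate_of_not_act {i j : ℕ} (h : ¬ Act w i j) : rate s w i j = 0 := if_neg h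

lemma rate_nonneg (hs : Spread s) (i j : ℕ) : 0 ≤ rate s w i j := by
  unfold rate
  split_ifs
  · have := hs.pos_all (w i)
    have := hs.pos_all (w j)
    positivity
  · exact le_rfl

lemma rate_add_swap_le (hs : Spread s) (i j : ℕ) :
    rate s w i j + rate s (w ∘ Equiv.swap i j) i j ≤ 1 := by
  by_cases h : Act w i j
  · rw [rate_of_act h, rate_of_act h.swap]
    have := pow_pos (hs.pos_all (w i)) (j - i)
    have := pow_pos (hs.pos_all (w j)) (j - i)
    simp only [Function.comp_apply, Equiv.swap_apply_left, Equiv.swap_apply_right]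
    rw [add_comm (s (w j) ^ (j - i)), ← add_div, div_self (by positivity)]
  · have h' : ¬ Act (w ∘ Equiv.swap i j) i j := fun h' => h (by
      simpa only [swap_comp_swap] using h'.swap)
    rw [rate_of_not_act h, rate_of_not_act h']
    norm_num

lemma rateBounds (hs : Spread s) (w : ℕ → Fin 3) : RateBounds w (rate s w) where
  nonneg := rate_nonneg hs
  inactive i j h := if_neg h
  right_one i d h0 h1 := by
    unfold rate
    split_ifs
    · rw [h0, h1, Nat.add_sub_cancel_left]
      refine div_add_le (pow_pos hs.pos d) (by positivity) ?_
      rw [← mul_pow]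
      exact pow_le_pow_left₀ (by have := hs.pos; positivity) hs.one d
    · positivity
  right_two i d h0 h1 := by
    unfold rate
    split_ifs
    · rw [h0, h1, Nat.add_sub_cancel_left]
      refine div_add_le (pow_pos hs.pos d) (by positivity) ?_
      rw [← mul_pow]
      exact pow_le_pow_left₀ (by have := hs.pos; positivity)
        (by have := hs.one; have := hs.two; linarith) d
    · positivity
  left_one i d h h1 h0 := by
    rw [rate_of_act h, h0, h1, Nat.add_sub_cancel_left]
    refine le_div_add (pow_pos hs.pos d) (by positivity) ?_ (pow_pos (hs.pos_all 1) d)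
    rw [← mul_pow]
    exact pow_le_pow_left₀ (by have := hs.pos; positivity) hs.one d
  left_two i d h h1 h0 := by
    rw [rate_of_act h, h0, h1, Nat.add_sub_cancel_left]
    refine le_trans (by norm_num) (le_div_add (K := 4) (pow_pos hs.pos d) (by norm_num) ?_
      (pow_pos (hs.pos_all 2) d))
    have hd : 1 ≤ d := by have := h.1; omega
    have h4 : (4 : ℝ) ≤ 4 ^ d := by
      simpa using pow_le_pow_right₀ (by norm_num : (1 : ℝ) ≤ 4) hd
    calc 4 * s 0 ^ d ≤ 4 ^ d * s 0 ^ d :=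
          mul_le_mul_of_nonneg_right h4 (pow_pos hs.pos d).le
      _ = (4 * s 0) ^ d := (mul_pow _ _ _).symm
      _ ≤ _ := pow_le_pow_left₀ (by have := hs.pos; positivity)
        (by have := hs.one; have := hs.two; linarith) d

end Moves

section Reversal

variable {w : ℕ → Fin 3} {n : ℕ} {s : Fin 3 → ℝ}

/-- The word read backwards, with the letters `A` and `C` exchanged. -/
def revWord (n : ℕ) (w : ℕ → Fin 3) : ℕ → Fin 3 := fun x => Fin.rev (w (n - 1 - x))

/-- The strengths of the reversed system. -/
noncomputable def revStrength (s : Fin 3 → ℝ) : Fin 3 → ℝ := fun l => (s (Fin.rev l))⁻¹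

lemma Spread.rev (hs : Spread s) : Spread (revStrength s) := by
  have h0 := hs.pos
  have h1 := hs.one
  have h2 := hs.two
  refine ⟨inv_pos.2 (hs.pos_all _), ?_, ?_⟩
  · show 2 * (s 2)⁻¹ ≤ (s 1)⁻¹
    rw [← div_eq_mul_inv, div_le_iff₀ (by linarith), ← div_eq_inv_mul,
      le_div_iff₀ (by linarith)]
    exact h2
  · show 2 * (s 1)⁻¹ ≤ (s 0)⁻¹
    rw [← div_eq_mul_inv, div_le_iff₀ (by linarith), ← div_eq_inv_mul,
      le_div_iff₀ (by linarith)]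
    exact h1

lemma act_revWord {i j : ℕ} (hij : i < j) (hjn : j < n) :
    Act (revWord n w) (n - 1 - j) (n - 1 - i) ↔ Act w i j := by
  unfold Act revWord
  rw [show n - 1 - (n - 1 - j) = j by omega, show n - 1 - (n - 1 - i) = i by omega]
  refine and_congr (by omega) (and_congr ?_ ⟨fun h l h1 h2 => ?_, fun h l h1 h2 => ?_⟩)
  · rw [ne_eq, ne_eq, Fin.rev_inj, eq_comm]
  · have := h (n - 1 - l) (by omega) (by omega)
    rw [show n - 1 - (n - 1 - l) = l by omega] at this
    exact Fin.rev_injective (this.trans (by decide))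
  · rw [h (n - 1 - l) (by omega) (by omega)]; decide

lemma rate_revWord (hs : Spread s) {i j : ℕ} (hij : i < j) (hjn : j < n) :
    rate (revStrength s) (revWord n w) (n - 1 - j) (n - 1 - i) = rate s w i j := by
  by_cases h : Act w i j
  · rw [rate_of_act h, rate_of_act ((act_revWord hij hjn).2 h)]
    unfold revWord revStrength
    rw [show n - 1 - (n - 1 - j) = j by omega, show n - 1 - (n - 1 - i) = i by omega,
      Fin.rev_rev, Fin.rev_rev, show n - 1 - i - (n - 1 - j) = j - i by omega, inv_pow, inv_pow]
    have := pow_pos (hs.pos_all (w i)) (j - i)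
    have := pow_pos (hs.pos_all (w j)) (j - i)
    field_simp
  · rw [rate_of_not_act h, rate_of_not_act fun h' => h ((act_revWord hij hjn).1 h')]

lemma revWord_swap {i j : ℕ} (hij : i < j) (hjn : j < n) {x : ℕ} (hx : x < n) :
    revWord n (w ∘ Equiv.swap i j) x =
      (revWord n w ∘ Equiv.swap (n - 1 - j) (n - 1 - i)) x := by
  unfold revWord
  simp only [Function.comp_apply]
  by_cases h1 : x = n - 1 - j
  · subst h1
    rw [Equiv.swap_apply_left, show n - 1 - (n - 1 - j) = j by omega, Equiv.swap_apply_right,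
      show n - 1 - (n - 1 - i) = i by omega]
  · by_cases h2 : x = n - 1 - i
    · subst h2
      rw [Equiv.swap_apply_right, show n - 1 - (n - 1 - i) = i by omega, Equiv.swap_apply_left,
        show n - 1 - (n - 1 - j) = j by omega]
    · rw [Equiv.swap_apply_of_ne_of_ne h1 h2, Equiv.swap_apply_of_ne_of_ne (by omega) (by omega)]

/-- The Lyapunov function. -/
noncomputable def lyap (n : ℕ) (w : ℕ → Fin 3) : ℝ := 1 + potA w n + potA (revWord n w) n

lemma one_le_lyap (n : ℕ) (w : ℕ → Fin 3) : 1 ≤ lyap n w := by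
  have h1 := potA_nonneg (w := w) (n := n)
  have h2 := potA_nonneg (w := revWord n w) (n := n)
  unfold lyap; linarith

lemma lyap_drift (hs : Spread s) (w : ℕ → Fin 3) :
    pairSum n (fun i j => rate s w i j * (lyap n (w ∘ Equiv.swap i j) - lyap n w)) ≤
      - (1 / 20) * lyap n w + 1 / 4 := by
  have h1 := pairSum_potA_le (n := n) (rateBounds hs w)
  have h2 := pairSum_potA_le (n := n) (rateBounds hs.rev (revWord n w))
  rw [← pairSum_reflect] at h2
  have h3 : pairSum n (fun i j => rate s w i j * (lyap n (w ∘ Equiv.swap i j) - lyap n w)) =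
      pairSum n (fun i j => rate s w i j * (potA (w ∘ Equiv.swap i j) n - potA w n)) +
      pairSum n (fun i j => rate (revStrength s) (revWord n w) (n - 1 - j) (n - 1 - i) *
        (potA (revWord n w ∘ Equiv.swap (n - 1 - j) (n - 1 - i)) n - potA (revWord n w) n)) := by
    unfold pairSum
    rw [← sum_add_distrib]
    refine sum_congr rfl fun i _ => ?_
    rw [← sum_add_distrib]
    refine sum_congr rfl fun j hj => ?_
    beta_reduce
    split_ifs with hij
    · rw [rate_revWord hs hij (mem_range.1 hj), lyap, lyap,
        potA_congr fun y hy => revWord_swap (w := w) hij (mem_range.1 hj) hy]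
      ring
    · ring
  rw [h3]
  have h4 := potA_nonneg (w := w) (n := n)
  have h5 := potA_nonneg (w := revWord n w) (n := n)
  unfold lyap
  linarith

end Reversal

section Descents

variable {w : ℕ → Fin 3} {n : ℕ} {s : Fin 3 → ℝ}

lemma act_succ {i : ℕ} (h : w (i + 1) ≠ w i) : Act w i (i + 1) :=
  ⟨by omega, h.symm, fun l h1 h2 => by omega⟩

lemma half_le_rate_of_descent (hs : Spread s) {i : ℕ} (h : w (i + 1) < w i) :
    1 / 2 ≤ rate s w i (i + 1) := by
  rw [rate_of_act (act_succ h.ne), Nat.add_sub_cancel_left, pow_one, pow_one]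
  have h1 := hs.pos_all (w i)
  have h2 := hs.pos_all (w (i + 1))
  have h3 := hs.strictMono h
  rw [div_le_div_iff₀ (by norm_num) (by linarith)]
  linarith

lemma potA_descent_le {i : ℕ} (hi : i + 1 < n) (h : w (i + 1) < w i) :
    potA (w ∘ Equiv.swap i (i + 1)) n ≤ potA w n := by
  have hact := act_succ h.ne
  by_cases h0 : w (i + 1) = 0
  · have h1 := potA_swap_of_right hact hi h0
    have h2 := growth_mono (w := w) (Nat.le_succ i)
    have h3 := mul_nonneg (zero_le_one.trans (one_le_weight (w := w) (n := n) (i + 1)))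
      (sub_nonneg.2 h2)
    have h4 : w i.succ = w (i + 1) := rfl
    have h5 : growth w i.succ = growth w (i + 1) := rfl
    rw [h5] at h3
    linarith
  · have h1 := potA_swap_of_ne hact hi (fun e => by rw [e] at h; exact absurd h (by simp)) h0
    linarith

lemma growth_succ_sub {i : ℕ} (h : w i ≠ 0) : 1 / 100 ≤ growth w (i + 1) - growth w i := by
  have h1 := one_le_growth (w := w) i
  rw [growth_succ]
  have h2 : 101 / 100 ≤ letterGrowth (w i) := by
    revert h
    generalize w i = l
    fin_cases l <;> norm_num [letterGrowth]
  nlinarith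

lemma potA_descent_le_sub {i : ℕ} (hi : i + 1 < n) (h : w (i + 1) < w i) (h0 : w (i + 1) = 0) :
    potA (w ∘ Equiv.swap i (i + 1)) n ≤ potA w n - 1 / 100 := by
  have h1 := potA_swap_of_right (act_succ h.ne) hi h0
  have h2 := growth_succ_sub (w := w) (i := i) (by rw [h0] at h; exact h.ne')
  have h3 := one_le_weight (w := w) (n := n) (i + 1)
  nlinarith

lemma lyap_descent_le (w : ℕ → Fin 3) {i : ℕ} (hi : i + 1 < n) (h : w (i + 1) < w i) :
    lyap n (w ∘ Equiv.swap i (i + 1)) ≤ lyap n w - 1 / 100 := by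
  have e : potA (revWord n (w ∘ Equiv.swap i (i + 1))) n =
      potA (revWord n w ∘ Equiv.swap (n - 2 - i) (n - 2 - i + 1)) n := by
    refine potA_congr fun y hy => ?_
    rw [revWord_swap (Nat.lt_succ_self i) hi hy]
    congr 3 <;> omega
  have hi' : n - 2 - i + 1 < n := by omega
  have h' : revWord n w (n - 2 - i + 1) < revWord n w (n - 2 - i) := by
    unfold revWord
    rw [show n - 1 - (n - 2 - i + 1) = i by omega, show n - 1 - (n - 2 - i) = i + 1 by omega,
      Fin.rev_lt_rev]
    exact h
  unfold lyap
  rw [e]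
  by_cases h0 : w (i + 1) = 0
  · have h1 := potA_descent_le_sub hi h h0
    have h2 := potA_descent_le hi' h'
    linarith
  · have h1 := potA_descent_le hi h
    have h2 := potA_descent_le_sub hi' h' (by
      unfold revWord
      rw [show n - 1 - (n - 2 - i + 1) = i by omega]
      have : w i = 2 := by omega
      rw [this]; decide)
    linarith

/-- Positions of letters `A` followed by a different letter. -/
def ascentsA (w : ℕ → Fin 3) (n : ℕ) : Finset ℕ :=
  (range (n - 1)).filter fun p => w p = 0 ∧ w (p + 1) ≠ 0

lemma card_ascentsA_le (w : ℕ → Fin 3) (n : ℕ) :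
    ((ascentsA w n).card : ℝ) ≤ 1 + 100 * potA w n := by
  have hnn := potA_nonneg (w := w) (n := n)
  rcases (ascentsA w n).eq_empty_or_nonempty with h | h
  · rw [h]; simp; linarith
  · set p₀ := (ascentsA w n).min' h with hp₀
    have hmem := (ascentsA w n).min'_mem h
    rw [← card_erase_add_one hmem]
    have h1 : ∀ x ∈ (ascentsA w n).erase p₀, 1 / 100 ≤ potTerm w n x := by
      intro x hx
      obtain ⟨hne, hx'⟩ := mem_erase.1 hx
      have hle := (ascentsA w n).min'_le x hx'
      rw [← hp₀] at hle hmem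
      have hx0 := (mem_filter.1 hx').2.1
      have hp1 := (mem_filter.1 hmem).2.2
      have hlt : p₀ + 2 ≤ x := by
        by_contra hcon
        have : x = p₀ + 1 := by omega
        exact hp1 (this ▸ hx0)
      have g1 := growth_succ_sub hp1
      have g2 := growth_mono (w := w) hlt
      have g3 := one_le_growth (w := w) (p₀ + 1)
      have g4 := one_le_weight (w := w) (n := n) x
      unfold potTerm
      rw [if_pos hx0]
      nlinarith
    have h2 : ∑ x ∈ (ascentsA w n).erase p₀, potTerm w n x ≤ potA w n := by
      refine sum_le_sum_of_subset_of_nonneg (fun x hx => ?_) fun x _ _ => ?_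
      · have := (mem_filter.1 (mem_erase.1 hx).2).1
        rw [mem_range] at this ⊢
        omega
      · unfold potTerm
        split_ifs
        · exact mul_nonneg (zero_le_one.trans (one_le_weight x))
            (sub_nonneg.2 (one_le_growth x))
        · exact le_rfl
    have h3 := card_nsmul_le_sum _ _ _ h1
    rw [nsmul_eq_mul] at h3
    push_cast
    linarith

/-- Positions followed by a larger letter. -/
def ascents (w : ℕ → Fin 3) (n : ℕ) : Finset ℕ :=
  (range (n - 1)).filter fun p => w p < w (p + 1)

lemma card_ascents_le (w : ℕ → Fin 3) (n : ℕ) :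
    ((ascents w n).card : ℝ) ≤ 100 * lyap n w := by
  have hsub : ascents w n ⊆
      ascentsA w n ∪ (ascentsA (revWord n w) n).image fun p => n - 2 - p := by
    intro p hp
    obtain ⟨hp1, hp2⟩ := mem_filter.1 hp
    have hp3 := mem_range.1 hp1
    rw [mem_union]
    by_cases h0 : w p = 0
    · left
      exact mem_filter.2 ⟨hp1, h0, by rw [h0] at hp2; exact hp2.ne'⟩
    · right
      refine mem_image.2 ⟨n - 2 - p, mem_filter.2 ⟨mem_range.2 (by omega), ?_, ?_⟩, by omega⟩
      · unfold revWord
        rw [show n - 1 - (n - 2 - p) = p + 1 by omega]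
        have : w (p + 1) = 2 := by omega
        rw [this]; decide
      · unfold revWord
        rw [show n - 1 - (n - 2 - p + 1) = p by omega]
        have : w p = 1 := by omega
        rw [this]; decide
  have h1 := (card_le_card hsub).trans ((card_union_le _ _).trans
    (Nat.add_le_add_left card_image_le _))
  have h2 : ((ascents w n).card : ℝ) ≤
      (ascentsA w n).card + (ascentsA (revWord n w) n).card := by exact_mod_cast h1
  have h3 := card_ascentsA_le w n
  have h4 := card_ascentsA_le (revWord n w) n
  unfold lyap
  linarith

end Descents

section States

variable {n : ℕ} {cnt : Fin 3 → ℕ} {s : Fin 3 → ℝ}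

/-- Extension of a word of length `n` to all positions. -/
def extWord (v : Fin n → Fin 3) (x : ℕ) : Fin 3 := if h : x < n then v ⟨x, h⟩ else 1

lemma extWord_coe (v : Fin n → Fin 3) (i : Fin n) : extWord v i = v i := by
  simp [extWord]

lemma extWord_swap (v : Fin n → Fin 3) (i j : Fin n) :
    extWord (v ∘ Equiv.swap i j) = extWord v ∘ Equiv.swap (i : ℕ) (j : ℕ) := by
  funext x
  by_cases hx : x < n
  · obtain ⟨k, rfl⟩ : ∃ k : Fin n, (k : ℕ) = x := ⟨⟨x, hx⟩, rfl⟩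
    rw [extWord_coe, Function.comp_apply, Function.comp_apply]
    by_cases h1 : k = i
    · subst h1; rw [Equiv.swap_apply_left, Equiv.swap_apply_left, extWord_coe]
    · by_cases h2 : k = j
      · subst h2; rw [Equiv.swap_apply_right, Equiv.swap_apply_right, extWord_coe]
      · rw [Equiv.swap_apply_of_ne_of_ne h1 h2, Equiv.swap_apply_of_ne_of_ne
          (fun h => h1 (Fin.ext h)) (fun h => h2 (Fin.ext h)), extWord_coe]
  · have := i.2
    have := j.2
    rw [Function.comp_apply, Equiv.swap_apply_of_ne_of_ne (by omega) (by omega)]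
    simp [extWord, hx]

lemma act_extWord (v : Fin n → Fin 3) (i j : Fin n) :
    Act (extWord v) i j ↔ i < j ∧ v i ≠ v j ∧ ∀ l, i < l → l < j → v l = 1 := by
  unfold Act
  rw [extWord_coe, extWord_coe]
  refine and_congr Iff.rfl (and_congr Iff.rfl ⟨fun h l h1 h2 => ?_, fun h l h1 h2 => ?_⟩)
  · rw [← extWord_coe v]; exact h l h1 h2
  · have hl : l < n := h2.trans j.2
    exact (extWord_coe v ⟨l, hl⟩).trans (h ⟨l, hl⟩ h1 h2)

/-- Pairs of positions. -/
abbrev Pairs (n : ℕ) : Type := {p : Fin n × Fin n // p.1 < p.2}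

lemma sum_pairs {M : Type*} [AddCommMonoid M] (F : Fin n → Fin n → M) :
    ∑ e : Pairs n, F e.1.1 e.1.2 = ∑ i, ∑ j, if i < j then F i j else 0 := by
  rw [← Fintype.sum_prod_type' (f := fun i j => if i < j then F i j else 0), ← sum_filter,
    ← sum_subtype_eq_sum_filter]
  simp

lemma card_pairs (n : ℕ) : Fintype.card (Pairs n) = n.choose 2 := by
  have h := sum_pairs (n := n) fun _ _ => 1
  rw [sum_const, smul_eq_mul, mul_one, card_univ] at h
  rw [h, sum_comm, Nat.choose_two_right, ← sum_range_id, sum_range]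
  refine sum_congr rfl fun j _ => ?_
  rw [← card_filter, filter_gt_eq_Iio, Fin.card_Iio]

lemma sum_pairs_eq_pairSum (F : ℕ → ℕ → ℝ) :
    ∑ e : Pairs n, F e.1.1 e.1.2 = pairSum n F := by
  rw [sum_pairs (fun i j : Fin n => F i j)]
  unfold pairSum
  rw [sum_range]
  refine sum_congr rfl fun i _ => ?_
  rw [sum_range]
  rfl

/-- Exchange of the letters in a pair of positions. -/
def swapState (e : Pairs n) (v : PSpace n 3 cnt) : PSpace n 3 cnt :=
  ⟨v.1 ∘ Equiv.swap e.1.1 e.1.2, fun l => by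
    rw [← v.2 l]
    refine card_equiv (Equiv.swap e.1.1 e.1.2) fun x => ?_
    simp⟩

lemma swapState_swapState (e : Pairs n) (v : PSpace n 3 cnt) :
    swapState e (swapState e v) = v := by
  apply Subtype.ext
  funext x
  simp [swapState]

/-- Rate of the exchange of the letters in a pair of positions. -/
noncomputable def stateRate (s : Fin 3 → ℝ) (e : Pairs n) (v : PSpace n 3 cnt) : ℝ :=
  rate s (extWord v.1) e.1.1 e.1.2

lemma extWord_swapState (e : Pairs n) (v : PSpace n 3 cnt) :
    extWord (swapState e v).1 = extWord v.1 ∘ Equiv.swap (e.1.1 : ℕ) (e.1.2 : ℕ) :=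
  extWord_swap _ _ _

lemma partW_pos (hs : ∀ l, 0 < s l) (v : PSpace n 3 cnt) : 0 < partW n 3 cnt s v :=
  prod_pos fun _ _ => pow_pos (hs _) _

lemma partPi_pos (hs : ∀ l, 0 < s l) (v : PSpace n 3 cnt) : 0 < partPi n 3 cnt s v :=
  div_pos (partW_pos hs v) (sum_pos (fun u _ => partW_pos hs u) ⟨v, mem_univ _⟩)

lemma sum_partPi [Nonempty (PSpace n 3 cnt)] (hs : ∀ l, 0 < s l) :
    ∑ v, partPi n 3 cnt s v = 1 := by
  unfold partPi
  rw [← sum_div]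
  exact div_self (sum_pos (fun u _ => partW_pos hs u) univ_nonempty).ne'

lemma partW_swap (e : Pairs n) (v : PSpace n 3 cnt) :
    partW n 3 cnt s v * s (v.1 e.1.1) ^ ((e.1.2 : ℕ) - e.1.1) =
      partW n 3 cnt s (swapState e v) * s (v.1 e.1.2) ^ ((e.1.2 : ℕ) - e.1.1) := by
  obtain ⟨⟨i, j⟩, hij⟩ := e
  simp only at hij ⊢
  have key : ∀ F : Fin n → ℝ, ∏ x, F x = (∏ x ∈ univ \ {i, j}, F x) * (F i * F j) := by
    intro F
    rw [← prod_pair hij.ne, prod_sdiff (subset_univ _)]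
  unfold partW
  rw [key, key fun x => s ((swapState ⟨(i, j), hij⟩ v).1 x) ^ ((x : ℕ) + 1)]
  have h1 : ∏ x ∈ univ \ {i, j}, s ((swapState ⟨(i, j), hij⟩ v).1 x) ^ ((x : ℕ) + 1) =
      ∏ x ∈ univ \ {i, j}, s (v.1 x) ^ ((x : ℕ) + 1) := by
    refine prod_congr rfl fun x hx => ?_
    simp only [mem_sdiff, mem_univ, true_and, mem_insert, mem_singleton, not_or] at hx
    simp [swapState, Equiv.swap_apply_of_ne_of_ne hx.1 hx.2]
  rw [h1]
  simp only [swapState, Function.comp_apply, Equiv.swap_apply_left, Equiv.swap_apply_right]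
  obtain ⟨d, hd⟩ := Nat.exists_eq_add_of_lt (show (i : ℕ) < j from hij)
  rw [hd, show (i : ℕ) + d + 1 - i = d + 1 by omega]
  ring

lemma reversible (e : Pairs n) (v : PSpace n 3 cnt) :
    partPi n 3 cnt s v * stateRate s e v =
      partPi n 3 cnt s (swapState e v) * stateRate s e (swapState e v) := by
  unfold stateRate partPi
  rw [extWord_swapState]
  by_cases h : Act (extWord v.1) e.1.1 e.1.2
  · rw [rate_of_act h, rate_of_act h.swap]
    simp only [Function.comp_apply, Equiv.swap_apply_left, Equiv.swap_apply_right, extWord_coe]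
    rw [add_comm (s (v.1 e.1.2) ^ _), div_mul_div_comm, div_mul_div_comm, partW_swap]
  · have h' : ¬ Act (extWord v.1 ∘ Equiv.swap (e.1.1 : ℕ) (e.1.2 : ℕ)) e.1.1 e.1.2 := fun h' => h (by
      simpa only [swap_comp_swap] using h'.swap)
    rw [rate_of_not_act h, rate_of_not_act h', mul_zero, mul_zero]

lemma edgeGen_lyap_le (hs : Spread s) (v : PSpace n 3 cnt) :
    edgeGen swapState (stateRate s) (fun u : PSpace n 3 cnt => lyap n (extWord u.1)) v ≤
      - (1 / 20) * lyap n (extWord v.1) + 1 / 4 := by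
  refine le_trans (le_of_eq ?_) (lyap_drift (n := n) hs (extWord v.1))
  unfold edgeGen stateRate
  rw [← sum_pairs_eq_pairSum]
  simp only [extWord_swapState]

/-- The pair consists of adjacent positions carrying letters in decreasing order. -/
def IsDescent (e : Pairs n) (v : PSpace n 3 cnt) : Prop :=
  (e.1.2 : ℕ) = e.1.1 + 1 ∧ v.1 e.1.2 < v.1 e.1.1

instance (e : Pairs n) (v : PSpace n 3 cnt) : Decidable (IsDescent e v) :=
  inferInstanceAs (Decidable (_ ∧ _))

lemma IsDescent.extWord_lt {e : Pairs n} {v : PSpace n 3 cnt} (h : IsDescent e v) :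
    extWord v.1 (e.1.1 + 1) < extWord v.1 e.1.1 := by
  rw [← h.1, extWord_coe, extWord_coe]; exact h.2

lemma IsDescent.rate_and_lyap (hs : Spread s) {e : Pairs n} {v : PSpace n 3 cnt}
    (h : IsDescent e v) : 1 / 2 ≤ stateRate s e v ∧
      lyap n (extWord (swapState e v).1) ≤ lyap n (extWord v.1) - 1 / 100 := by
  rw [extWord_swapState]
  unfold stateRate
  have h2 : (e.1.1 : ℕ) + 1 < n := h.1 ▸ e.1.2.2
  rw [h.1]
  exact ⟨half_le_rate_of_descent hs h.extWord_lt, lyap_descent_le _ h2 h.extWord_lt⟩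

lemma card_descents_le (v : PSpace n 3 cnt) :
    ((univ.filter fun e => IsDescent e (swapState e v)).card : ℝ) ≤
      100 * lyap n (extWord v.1) := by
  refine le_trans ?_ (card_ascents_le (extWord v.1) n)
  have : (univ.filter fun e => IsDescent e (swapState e v)).card ≤
      (ascents (extWord v.1) n).card := by
    refine card_le_card_of_injOn (fun e => (e.1.1 : ℕ)) ?_ ?_
    · intro e he
      have he' := (mem_filter.1 he).2
      have h1 := he'.extWord_lt
      have h2 := e.1.2.2
      rw [extWord_swapState, ← he'.1, Function.comp_apply, Function.comp_apply,
        Equiv.swap_apply_left, Equiv.swap_apply_right, he'.1] at h1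
      refine mem_coe.2 (mem_filter.2 ⟨mem_range.2 ?_, h1⟩)
      have := he'.1
      beta_reduce
      omega
    · intro e he e' he' h
      have h1 := (mem_filter.1 he).2.1
      have h2 := (mem_filter.1 he').2.1
      have h3 : (e.1.1 : ℕ) = e'.1.1 := h
      exact Subtype.ext (Prod.ext (Fin.ext h3) (Fin.ext (by rw [h1, h2, h3])))
  exact_mod_cast this

lemma monotone_of_forall_not_isDescent {v : PSpace n 3 cnt} (h : ∀ e, ¬ IsDescent e v) :
    Monotone v.1 := by
  obtain _ | m := n
  · exact fun i => i.elim0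
  · refine Fin.monotone_iff_le_succ.2 fun i => ?_
    by_contra hlt
    exact h ⟨(i.castSucc, i.succ), Fin.castSucc_lt_succ⟩ ⟨by simp, not_le.1 hlt⟩

lemma card_filter_le_eq (v : PSpace n 3 cnt) (l : Fin 3) :
    (univ.filter fun i => v.1 i ≤ l).card = ∑ b ∈ univ.filter (· ≤ l), cnt b := by
  rw [card_eq_sum_card_fiberwise (f := v.1) (t := univ.filter (· ≤ l))]
  · refine sum_congr rfl fun b hb => ?_
    rw [← v.2 b, filter_filter]
    congr 1
    ext i
    have := (mem_filter.1 hb).2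
    simp only [mem_filter, mem_univ, true_and]
    exact ⟨fun h => h.2, fun h => ⟨h ▸ this, h⟩⟩
  · intro i hi
    simpa using hi

lemma eq_of_monotone {v u : PSpace n 3 cnt} (hv : Monotone v.1) (hu : Monotone u.1) : v = u := by
  have key : ∀ i l, v.1 i ≤ l ↔ u.1 i ≤ l := fun i l => by
    rw [← Tuple.lt_card_le_iff_apply_le_of_monotone hv,
      ← Tuple.lt_card_le_iff_apply_le_of_monotone hu, card_filter_le_eq, card_filter_le_eq]
  exact Subtype.ext (funext fun i => le_antisymm ((key i _).2 le_rfl) ((key i _).1 le_rfl))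

lemma exists_sorted [Nonempty (PSpace n 3 cnt)] :
    ∃ o : PSpace n 3 cnt, ∀ v, v ≠ o → ∃ e, IsDescent e v := by
  have hs : Spread ![1, 2, 4] := ⟨by norm_num, by norm_num, by
    show (2 : ℝ) * 2 ≤ 4; norm_num⟩
  obtain ⟨o, ho⟩ := Finite.exists_min fun v : PSpace n 3 cnt => lyap n (extWord v.1)
  have h1 : Monotone o.1 := monotone_of_forall_not_isDescent fun e he => by
    have h2 := (he.rate_and_lyap hs).2
    have h3 := ho (swapState e o)
    linarith
  refine ⟨o, fun v hv => ?_⟩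
  by_contra hcon
  push Not at hcon
  exact hv (eq_of_monotone (monotone_of_forall_not_isDescent hcon) h1)

/-- The constant in the Poincaré inequality. -/
noncomputable def poincareConst : ℝ := 40 + 9 * levelConst (1 / 100) 100 900

lemma one_le_poincareConst : 1 ≤ poincareConst := by
  have := levelConst_nonneg (δ := 1 / 100) (B := 100) (by norm_num) (by norm_num) 900
  unfold poincareConst; linarith

lemma poincare (hs : Spread s) [Nonempty (PSpace n 3 cnt)] [Nonempty (Pairs n)]
    (f : PSpace n 3 cnt → ℝ) (hf : ∑ x, partPi n 3 cnt s x * f x = 0) :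
    ∑ x, partPi n 3 cnt s x * f x ^ 2 ≤
      poincareConst * edgeEnergy swapState (stateRate s) (partPi n 3 cnt s) f := by
  obtain ⟨o, ho⟩ := exists_sorted (n := n) (cnt := cnt)
  exact poincare_of_lyapunov swapState_swapState reversible (partPi_pos hs.pos_all)
    (sum_partPi hs.pos_all) (fun e v => rate_nonneg hs _ _)
    (fun e v => by
      unfold stateRate
      rw [extWord_swapState]
      exact rate_add_swap_le hs _ _)
    (V := fun v => lyap n (extWord v.1)) (fun v => one_le_lyap _ _) (edgeGen_lyap_le hs)
    IsDescent (fun e v h => h.rate_and_lyap hs) o ho card_descents_le hf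

end States

section Chain

lemma word_eq_self {n : ℕ} {v : Fin n → Fin 3} {i j k : Fin n} {l : Fin 3} (hk : v k = l)
    (h : ∀ x, i ≤ x → x ≤ j → x ≠ k → v x = 1) :
    (fun x => if x = k then l else if i ≤ x ∧ x ≤ j then 1 else v x) = v := by
  funext x
  split_ifs with h1 h2
  · rw [h1, hk]
  · exact (h x h2.1 h2.2 h1).symm
  · rfl

lemma word_eq_swap {n : ℕ} {v : Fin n → Fin 3} {i j k m : Fin n} {l : Fin 3} (hk : v k = l)
    (hik : i ≤ k) (hkj : k ≤ j) (him : i ≤ m) (hmj : m ≤ j)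
    (h : ∀ x, i ≤ x → x ≤ j → x ≠ k → v x = 1) :
    (fun x => if x = m then l else if i ≤ x ∧ x ≤ j then 1 else v x) =
      v ∘ Equiv.swap m k := by
  funext x
  simp only [Function.comp_apply]
  split_ifs with h1 h2
  · rw [h1, Equiv.swap_apply_left, hk]
  · by_cases h3 : x = k
    · rw [h3, Equiv.swap_apply_right, h m him hmj fun e => h1 (h3.trans e.symm)]
    · rw [Equiv.swap_apply_of_ne_of_ne h1 h3, h x h2.1 h2.2 h3]
  · rw [Equiv.swap_apply_of_ne_of_ne h1]
    rintro rfl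
    exact h2 ⟨hik, hkj⟩

lemma pair_eq_self {n : ℕ} {v : Fin n → Fin 3} {i j : Fin n} {l m : Fin 3} (hi : v i = l)
    (hj : v j = m) : (fun x => if x = i then l else if x = j then m else v x) = v := by
  funext x
  split_ifs with h1 h2
  · rw [h1, hi]
  · rw [h2, hj]
  · rfl

lemma pair_eq_swap {n : ℕ} {v : Fin n → Fin 3} {i j : Fin n} {l m : Fin 3} (hi : v i = m)
    (hj : v j = l) : (fun x => if x = i then l else if x = j then m else v x) =
      v ∘ Equiv.swap i j := by
  funext x
  simp only [Function.comp_apply]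
  split_ifs with h1 h2
  · rw [h1, Equiv.swap_apply_left, hj]
  · rw [h2, Equiv.swap_apply_right, hi]
  · rw [Equiv.swap_apply_of_ne_of_ne h1 h2]

lemma ratio_pow_div {x y : ℝ} (hx : 0 < x) (hy : 0 < y) (d : ℕ) :
    (y / x) ^ d / (1 + (y / x) ^ d) = y ^ d / (y ^ d + x ^ d) := by
  have := pow_pos hx d
  have := pow_pos hy d
  rw [div_pow]
  field_simp
  ring

lemma one_div_ratio_pow {x y : ℝ} (hx : 0 < x) (hy : 0 < y) (d : ℕ) :
    1 / (1 + (y / x) ^ d) = x ^ d / (x ^ d + y ^ d) := by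
  have := pow_pos hx d
  have := pow_pos hy d
  rw [div_pow]
  field_simp

lemma one_sub_ratio {x y : ℝ} (hx : 0 < x) (hy : 0 < y) (d : ℕ) :
    1 - x ^ d / (x ^ d + y ^ d) = y ^ d / (y ^ d + x ^ d) := by
  have := pow_pos hx d
  have := pow_pos hy d
  field_simp
  ring

variable {a b c : ℕ} {sA sB sC : ℝ}

lemma jumpP_apply (hA : 0 < sA) (hB : 0 < sB) (hC : 0 < sC)
    (v u : PSpace (a + b + c) 3 ![a, b, c]) :
    jumpP a b c sA sB sC v u = (1 / (Fintype.card (Pairs (a + b + c)) : ℝ)) *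
      ∑ e, ((1 - stateRate ![sA, sB, sC] e v) * (if u = v then 1 else 0) +
        stateRate ![sA, sB, sC] e v * (if u = swapState e v then 1 else 0)) := by
  unfold jumpP
  rw [card_pairs]
  congr 1
  have hF : ∀ e : Pairs (a + b + c),
      (1 - stateRate ![sA, sB, sC] e v) * (if u = v then 1 else 0) +
        stateRate ![sA, sB, sC] e v * (if u = swapState e v then 1 else 0) =
      (1 - rate ![sA, sB, sC] (extWord v.1) e.1.1 e.1.2) * (if u = v then 1 else 0) +
        rate ![sA, sB, sC] (extWord v.1) e.1.1 e.1.2 *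
          (if u.1 = v.1 ∘ Equiv.swap e.1.1 e.1.2 then 1 else 0) := by
    intro e
    simp only [stateRate, swapState, Subtype.ext_iff]
  refine Eq.trans ?_ ((sum_congr rfl fun e _ => hF e).trans (sum_pairs
    (fun i j : Fin (a + b + c) =>
        (1 - rate ![sA, sB, sC] (extWord v.1) i j) * (if u = v then 1 else 0) +
        rate ![sA, sB, sC] (extWord v.1) i j *
          (if u.1 = v.1 ∘ Equiv.swap i j then 1 else 0)))).symm
  refine sum_congr rfl fun i _ => sum_congr rfl fun j _ => ?_
  by_cases hij : i < j
  swap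
  · rw [if_neg hij, if_neg hij]
  rw [if_pos hij, if_pos hij]
  beta_reduce
  rw [show (if u = v then (1 : ℝ) else 0) = (if u.1 = v.1 then 1 else 0) from
    if_congr Subtype.ext_iff rfl rfl]
  by_cases hact : Act (extWord v.1) i j
  · obtain ⟨-, hne, hb⟩ := (act_extWord v.1 i j).1 hact
    rw [rate_of_act hact, extWord_coe, extWord_coe]
    have hl : ∀ l : Fin 3, l = 0 ∨ l = 1 ∨ l = 2 := by decide
    have hright : v.1 j = 1 → ∀ l, i < l → l ≤ j → v.1 l = 1 := fun h l h1 h2 => by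
      rcases h2.eq_or_lt with rfl | h2
      · exact h
      · exact hb l h1 h2
    have hleft : v.1 i = 1 → ∀ l, i ≤ l → l < j → v.1 l = 1 := fun h l h1 h2 => by
      rcases h1.eq_or_lt with rfl | h1
      · exact h
      · exact hb l h1 h2
    have hright' : v.1 j = 1 → ∀ l, i ≤ l → l ≤ j → l ≠ i → v.1 l = 1 := fun h l h1 h2 h3 =>
      hright h l (lt_of_le_of_ne h1 (Ne.symm h3)) h2
    have hleft' : v.1 i = 1 → ∀ l, i ≤ l → l ≤ j → l ≠ j → v.1 l = 1 := fun h l h1 h2 h3 =>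
      hleft h l h1 (lt_of_le_of_ne h2 h3)
    have n1 : ¬ ((1 : Fin 3) = 0) := by decide
    have n2 : ¬ ((2 : Fin 3) = 0) := by decide
    have n3 : ¬ ((1 : Fin 3) = 2) := by decide
    have n4 : ¬ ((0 : Fin 3) = 2) := by decide
    rcases hl (v.1 i) with hi | hi | hi <;> rcases hl (v.1 j) with hj | hj | hj
    · exact absurd (hi.trans hj.symm) hne
    · rw [if_neg (by simp [hi, hj, n3, n4]), if_pos (Or.inl ⟨hi, hright hj⟩),
        word_eq_self hi (hright' hj),
        word_eq_swap hi le_rfl hij.le hij.le le_rfl (hright' hj), ratio_pow_div hA hB,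
        one_div_ratio_pow hA hB, hi, hj, Equiv.swap_comm]
      simp only [Matrix.cons_val]
      rw [one_sub_ratio hA hB]
    · rw [if_pos ⟨Or.inl ⟨hi, hj⟩, hb⟩, pair_eq_self hi hj, pair_eq_swap hi hj,
        ratio_pow_div hA hC, one_div_ratio_pow hA hC, hi, hj]
      simp only [Matrix.cons_val]
      rw [one_sub_ratio hA hC]
    · rw [if_neg (by simp [hi, hj, n3, n1]), if_pos (Or.inr ⟨hj, hleft hi⟩),
        word_eq_self hj (hleft' hi),
        word_eq_swap hj hij.le le_rfl le_rfl hij.le (hleft' hi), ratio_pow_div hA hB,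
        one_div_ratio_pow hA hB, hi, hj]
      simp only [Matrix.cons_val]
      rw [one_sub_ratio hB hA]; ring
    · exact absurd (hi.trans hj.symm) hne
    · rw [if_neg (by simp [hi, hj, n3, n1]), if_neg (by simp [hi, hj, n2, n1]),
        if_pos (Or.inr ⟨hj, hleft hi⟩), word_eq_self hj (hleft' hi),
        word_eq_swap hj hij.le le_rfl le_rfl hij.le (hleft' hi), ratio_pow_div hB hC,
        one_div_ratio_pow hB hC, hi, hj]
      simp only [Matrix.cons_val]
      rw [one_sub_ratio hB hC]
    · rw [if_pos ⟨Or.inr ⟨hi, hj⟩, hb⟩, pair_eq_self hi hj, pair_eq_swap hi hj,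
        ratio_pow_div hA hC, one_div_ratio_pow hA hC, hi, hj]
      simp only [Matrix.cons_val]
      rw [one_sub_ratio hC hA]; ring
    · rw [if_neg (by simp [hi, hj, n2, n1]), if_neg (by simp [hi, hj, n2, n1]),
        if_pos (Or.inl ⟨hi, hright hj⟩), word_eq_self hi (hright' hj),
        word_eq_swap hi le_rfl hij.le hij.le le_rfl (hright' hj), ratio_pow_div hB hC,
        one_div_ratio_pow hB hC, hi, hj, Equiv.swap_comm]
      simp only [Matrix.cons_val]
      rw [one_sub_ratio hC hB]; ring
    · exact absurd (hi.trans hj.symm) hne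
  · rw [rate_of_not_act hact]
    rw [act_extWord] at hact
    have n1 : ¬ ((1 : Fin 3) = 0) := by decide
    have n2 : ¬ ((2 : Fin 3) = 0) := by decide
    have n3 : ¬ ((1 : Fin 3) = 2) := by decide
    rw [if_neg, if_neg, if_neg]
    · ring
    · rintro (⟨h1, h2⟩ | ⟨h1, h2⟩)
      · exact hact ⟨hij, by rw [h1, h2 j hij le_rfl]; decide, fun l h3 h4 => h2 l h3 h4.le⟩
      · exact hact ⟨hij, by rw [h1, h2 i le_rfl hij]; decide, fun l h3 h4 => h2 l h3.le h4⟩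
    · rintro (⟨h1, h2⟩ | ⟨h1, h2⟩)
      · exact hact ⟨hij, by rw [h1, h2 j hij le_rfl]; decide, fun l h3 h4 => h2 l h3 h4.le⟩
      · exact hact ⟨hij, by rw [h1, h2 i le_rfl hij]; decide, fun l h3 h4 => h2 l h3.le h4⟩
    · rintro ⟨⟨h1, h2⟩ | ⟨h1, h2⟩, h3⟩
      · exact hact ⟨hij, by rw [h1, h2]; decide, h3⟩
      · exact hact ⟨hij, by rw [h1, h2]; decide, h3⟩

lemma pow_le_partPi {n : ℕ} {cnt : Fin 3 → ℕ} {s : Fin 3 → ℝ} (hs : Spread s)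
    (v : PSpace n 3 cnt) : (s 0 / s 2 / 3) ^ (n * n) ≤ partPi n 3 cnt s v := by
  have h0 := hs.pos_all 0
  have h2 := hs.pos_all 2
  have hlo : ∀ l, s 0 ≤ s l := fun l => hs.strictMono.monotone (Fin.zero_le l)
  have hhi : ∀ l, s l ≤ s 2 := fun l => hs.strictMono.monotone (Fin.le_last l)
  have hW : ∀ u : PSpace n 3 cnt, partW n 3 cnt s u ≤ ∏ x : Fin n, s 2 ^ ((x : ℕ) + 1) := fun u =>
    prod_le_prod (fun x _ => (pow_pos (hs.pos_all _) _).le)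
      fun x _ => pow_le_pow_left₀ (hs.pos_all _).le (hhi _) _
  have hcard : (Fintype.card (PSpace n 3 cnt) : ℝ) ≤ 3 ^ n := by
    have := Fintype.card_subtype_le
      (fun w : Fin n → Fin 3 => ∀ j : Fin 3, (univ.filter fun i => w i = j).card = cnt j)
    rw [Fintype.card_fun, Fintype.card_fin, Fintype.card_fin] at this
    exact_mod_cast this
  have hZ : ∑ u : PSpace n 3 cnt, partW n 3 cnt s u ≤
      ∏ x : Fin n, (3 * s 2 ^ ((x : ℕ) + 1)) := by
    calc _ ≤ ∑ u : PSpace n 3 cnt, ∏ x : Fin n, s 2 ^ ((x : ℕ) + 1) := sum_le_sum fun u _ => hW u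
      _ = Fintype.card (PSpace n 3 cnt) * ∏ x : Fin n, s 2 ^ ((x : ℕ) + 1) := by
          rw [sum_const, nsmul_eq_mul, card_univ]
      _ ≤ 3 ^ n * ∏ x : Fin n, s 2 ^ ((x : ℕ) + 1) :=
          mul_le_mul_of_nonneg_right hcard (prod_nonneg fun x _ => (pow_pos h2 _).le)
      _ = _ := by rw [prod_mul_distrib, prod_const, card_univ, Fintype.card_fin]
  unfold partPi
  rw [le_div_iff₀ (sum_pos (fun u _ => partW_pos hs.pos_all u) ⟨v, mem_univ _⟩)]
  have hq0 : 0 < s 0 / s 2 / 3 := by positivity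
  have hq1 : s 0 / s 2 / 3 ≤ 1 := by
    rw [div_div, div_le_one (by positivity)]
    linarith [hlo 2]
  calc (s 0 / s 2 / 3) ^ (n * n) * ∑ u : PSpace n 3 cnt, partW n 3 cnt s u
      ≤ (s 0 / s 2 / 3) ^ (n * n) * ∏ x : Fin n, (3 * s 2 ^ ((x : ℕ) + 1)) :=
        mul_le_mul_of_nonneg_left hZ (by positivity)
    _ = ∏ x : Fin n, ((s 0 / s 2 / 3) ^ n * (3 * s 2 ^ ((x : ℕ) + 1))) := by
        rw [pow_mul]
        conv_rhs => rw [prod_mul_distrib, prod_const, card_univ, Fintype.card_fin]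
    _ ≤ partW n 3 cnt s v := by
        refine prod_le_prod (fun x _ => by positivity) fun x _ => ?_
        refine le_trans ?_ (pow_le_pow_left₀ h0.le (hlo _) _)
        calc (s 0 / s 2 / 3) ^ n * (3 * s 2 ^ ((x : ℕ) + 1))
            ≤ (s 0 / s 2 / 3) ^ ((x : ℕ) + 1) * (3 * s 2 ^ ((x : ℕ) + 1)) :=
              mul_le_mul_of_nonneg_right (pow_le_pow_of_le_one hq0.le hq1 x.2) (by positivity)
          _ = s 0 ^ ((x : ℕ) + 1) * (1 / 3) ^ (x : ℕ) := by
              rw [div_pow, div_pow]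
              field_simp
              rw [pow_succ, mul_right_comm, ← mul_pow]
              norm_num
          _ ≤ s 0 ^ ((x : ℕ) + 1) * 1 :=
              mul_le_mul_of_nonneg_left (pow_le_one₀ (by norm_num) (by norm_num)) (by positivity)
          _ = _ := mul_one _

lemma mixingTime_le_one_of_eq_zero {Ω : Type*} [Fintype Ω] [DecidableEq Ω] (π : Ω → ℝ) :
    mixingTime (0 : Matrix Ω Ω ℝ) π ≤ 1 := by
  unfold mixingTime
  rcases Set.eq_empty_or_nonempty {T : ℕ | ∀ x : Ω, ∀ t : ℕ, T ≤ t →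
    (1 / 2) * ∑ y : Ω, |((0 : Matrix Ω Ω ℝ) ^ t) x y - π y| ≤ 1 / 4} with h | ⟨T, hT⟩
  · rw [h]; simp
  · refine Nat.sInf_le fun x t ht => ?_
    have := hT x (T + 1) (by omega)
    rwa [zero_pow (by omega)] at this ⊢

lemma mixingTime_jumpP_le (hs : Spread ![sA, sB, sC]) (hn : 1 ≤ a + b + c) :
    (mixingTime (jumpP a b c sA sB sC)
      (partPi (a + b + c) 3 ![a, b, c] ![sA, sB, sC]) : ℝ) ≤
      (poincareConst * (|Real.log (sA / sC / 3)| + 2) + 1) * ((a + b + c : ℕ) : ℝ) ^ 4 := by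
  have hA : 0 < sA := hs.pos_all 0
  have hB : 0 < sB := hs.pos_all 1
  have hC : 0 < sC := hs.pos_all 2
  set n := a + b + c with hn'
  have hn1 : (1 : ℝ) ≤ n := by exact_mod_cast hn
  have hP := one_le_poincareConst
  have hn4 : (1 : ℝ) ≤ (n : ℝ) ^ 4 := one_le_pow₀ hn1
  have hL := abs_nonneg (Real.log (sA / sC / 3))
  have hK : 0 ≤ poincareConst * (|Real.log (sA / sC / 3)| + 2) := by positivity
  rcases isEmpty_or_nonempty (PSpace n 3 ![a, b, c]) with hE | hE
  · have : mixingTime (jumpP a b c sA sB sC) (partPi n 3 ![a, b, c] ![sA, sB, sC]) ≤ 0 :=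
      Nat.sInf_le fun x => hE.elim x
    rw [Nat.le_zero.1 this, Nat.cast_zero]
    positivity
  rcases isEmpty_or_nonempty (Pairs n) with hp | hp
  · have h0 : jumpP a b c sA sB sC = 0 := by
      ext v u
      rw [jumpP_apply hA hB hC]
      simp
    rw [h0]
    have : (mixingTime (0 : Matrix (PSpace n 3 ![a, b, c]) _ ℝ)
      (partPi n 3 ![a, b, c] ![sA, sB, sC]) : ℝ) ≤ 1 := by
      exact_mod_cast mixingTime_le_one_of_eq_zero _
    nlinarith
  set C₀ := poincareConst
  set N : ℝ := (Fintype.card (Pairs n) : ℝ) with hN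
  have hN0 : 0 < N := by rw [hN]; exact_mod_cast Fintype.card_pos
  have hN1 : 1 ≤ N := by rw [hN]; exact_mod_cast Nat.succ_le_of_lt Fintype.card_pos
  have hN2 : N ≤ (n : ℝ) ^ 2 := by
    rw [hN, card_pairs]
    exact_mod_cast Nat.choose_le_pow n 2
  set L := |Real.log (sA / sC / 3)| with hLdef
  set A : ℝ := C₀ * N * ((n : ℝ) ^ 2 * L + 2) with hAdef
  have hA0 : 0 ≤ A := by positivity
  have hA1 : A ≤ C₀ * (L + 2) * (n : ℝ) ^ 4 := by
    have h1 : (n : ℝ) ^ 2 * L + 2 ≤ (n : ℝ) ^ 2 * (L + 2) := by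
      nlinarith [one_le_pow₀ hn1 (n := 2)]
    calc A ≤ C₀ * (n : ℝ) ^ 2 * ((n : ℝ) ^ 2 * (L + 2)) := by
          rw [hAdef]; gcongr
      _ = _ := by ring
  have hmem : mixingTime (jumpP a b c sA sB sC) (partPi n 3 ![a, b, c] ![sA, sB, sC]) ≤ ⌈A⌉₊ := by
    refine Nat.sInf_le fun x t ht => ?_
    have ht' : A ≤ t := (Nat.le_ceil A).trans (by exact_mod_cast ht)
    have hmain := sq_sum_abs_pow_sub_le (P := jumpP a b c sA sB sC)
      (jumpP_apply hA hB hC) swapState_swapState reversible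
      (partPi_pos hs.pos_all) (sum_partPi hs.pos_all) (fun e v => rate_nonneg hs _ _)
      (fun e v => by
        unfold stateRate
        rw [extWord_swapState]
        exact rate_add_swap_le hs _ _) hP (poincare hs) t x
    have hpi : (sA / sC / 3) ^ (n * n) ≤ partPi n 3 ![a, b, c] ![sA, sB, sC] x :=
      pow_le_partPi hs x
    have hpi0 := partPi_pos hs.pos_all x
    have hq : 0 < sA / sC / 3 := by positivity
    have hexp : (1 - 1 / (C₀ * N)) ^ t ≤ Real.exp (- (t / (C₀ * N))) := by
      have h1 : 1 - 1 / (C₀ * N) ≤ Real.exp (- (1 / (C₀ * N))) := by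
        have := Real.add_one_le_exp (- (1 / (C₀ * N)))
        linarith
      have h2 : 0 ≤ 1 - 1 / (C₀ * N) := by
        rw [sub_nonneg, div_le_one (by positivity)]
        nlinarith
      calc _ ≤ Real.exp (- (1 / (C₀ * N))) ^ t := pow_le_pow_left₀ h2 h1 t
        _ = _ := by rw [← Real.exp_nat_mul]; congr 1; ring
    have hexp2 : Real.exp (- (t / (C₀ * N))) ≤ 1 / 4 * (sA / sC / 3) ^ (n * n) := by
      have h1 : (n : ℝ) ^ 2 * L + 2 ≤ t / (C₀ * N) := by
        rw [le_div_iff₀ (by positivity)]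
        rw [hAdef] at ht'
        linarith
      have h2 : (sA / sC / 3) ^ (n * n) = Real.exp ((n : ℝ) ^ 2 * Real.log (sA / sC / 3)) := by
        have : (n : ℝ) ^ 2 = ((n * n : ℕ) : ℝ) := by push_cast; ring
        rw [this, Real.exp_nat_mul, Real.exp_log hq]
      have h3 : Real.exp (-2) ≤ 1 / 4 := by
        rw [Real.exp_neg, one_div]
        refine inv_anti₀ (by norm_num) ?_
        have h4 := Real.add_one_le_exp (1 : ℝ)
        have h5 : Real.exp 2 = Real.exp 1 * Real.exp 1 := by rw [← Real.exp_add]; norm_num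
        rw [h5]
        nlinarith
      calc _ ≤ Real.exp (-2 + (n : ℝ) ^ 2 * Real.log (sA / sC / 3)) := by
            refine Real.exp_le_exp.2 ?_
            have h6 : -L ≤ Real.log (sA / sC / 3) := neg_abs_le _
            nlinarith [mul_le_mul_of_nonneg_left h6 (sq_nonneg (n : ℝ))]
        _ = Real.exp (-2) * (sA / sC / 3) ^ (n * n) := by rw [Real.exp_add, h2]
        _ ≤ _ := mul_le_mul_of_nonneg_right h3 (by positivity)
    have hfin : (∑ y, |(jumpP a b c sA sB sC ^ t) x y -
        partPi n 3 ![a, b, c] ![sA, sB, sC] y|) ^ 2 ≤ (1 / 2) ^ 2 := by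
      refine hmain.trans ?_
      rw [div_le_iff₀ hpi0]
      calc _ ≤ Real.exp (- (t / (C₀ * N))) := hexp
        _ ≤ 1 / 4 * (sA / sC / 3) ^ (n * n) := hexp2
        _ ≤ _ := by linarith
    have := (sq_le_sq₀ (sum_nonneg fun y _ => abs_nonneg _) (by norm_num)).1 hfin
    linarith
  calc (mixingTime (jumpP a b c sA sB sC) (partPi n 3 ![a, b, c] ![sA, sB, sC]) : ℝ)
      ≤ (⌈A⌉₊ : ℝ) := by exact_mod_cast hmem
    _ ≤ A + 1 := (Nat.ceil_lt_add_one hA0).le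
    _ ≤ _ := by linarith

end Chain

/-- With `n = a+b+c ≥ 1` and strengths `0 < s_A < s_B < s_C`
satisfying `s_A/s_B ≤ 1/2` and `s_B/s_C ≤ 1/2`, the Jump/Hop chain `X_t(n)` on
`Ω_{a,b,c}` has mixing time `t(X_t(n)) ≤ C·n⁴` for a constant `C` depending only on
the ratios `s_A/s_B` and `s_B/s_C`. -/
theorem jumpHop_mixing (qAB qBC : ℝ) :
    ∃ C : ℝ, 0 < C ∧
      ∀ (a b c : ℕ) (sA sB sC : ℝ),
        1 ≤ a + b + c →
        0 < sA → sA < sB → sB < sC →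
        sA / sB = qAB → sB / sC = qBC → qAB ≤ 1 / 2 → qBC ≤ 1 / 2 →
        (mixingTime (jumpP a b c sA sB sC)
            (partPi (a + b + c) 3 ![a, b, c] ![sA, sB, sC]) : ℝ) ≤
          C * ((a + b + c : ℕ) : ℝ) ^ 4 := by
  have hP := one_le_poincareConst
  have hL := abs_nonneg (Real.log (qAB * qBC / 3))
  refine ⟨poincareConst * (|Real.log (qAB * qBC / 3)| + 2) + 1, by positivity, ?_⟩
  intro a b c sA sB sC hn hA hAB hBC rfl rfl h1 h2
  have hB := hA.trans hAB
  have hC := hB.trans hBC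
  have hs : Spread ![sA, sB, sC] := by
    refine ⟨hA, ?_, ?_⟩
    · show 2 * sA ≤ sB
      rw [div_le_iff₀ hB] at h1
      linarith
    · show 2 * sB ≤ sC
      rw [div_le_iff₀ hC] at h2
      linarith
  rw [div_mul_div_cancel₀ hB.ne']
  exact mixingTime_jumpP_le hs hn
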